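/- Let T > 0 and let L > 0 with L ∉ 𝔽. Then there exists a constant C > 0, depending only on L and T, such that every classical solution ψ on [0,L]×[0,T] of the backward adjoint linear KdV system ψ_t + ψ_x + ψ_{xxx} = 0 with boundary conditions ψ(0,t) = 0, ψ_x(0,t) = 0 and ψ(L,t) + ψ_{xx}(L,t) = 0 satisfies the observability inequality ∫₀^L ψ(x,T)² dx ≤ C ∫₀^T ψ_x(L,t)² dt. -/

import Mathlib

open MeasureTheory Set

/-- The set `𝔽` of critical lengths for the linear KdV system controlled through
the single Neumann input `y_x(L,t)`:
`𝔽 = {L > 0 : ∃ a b ∈ ℂ, L² = −(a² + ab + b²) and e^a/a² = e^b/b² = e^{−(a+b)}/(a+b)²}`. -/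
def kdvCriticalSetF : Set ℝ :=
  {L : ℝ | 0 < L ∧ ∃ a b : ℂ, a ≠ 0 ∧ b ≠ 0 ∧ a + b ≠ 0 ∧
    (L : ℂ) ^ 2 = -(a ^ 2 + a * b + b ^ 2) ∧
    Complex.exp a / a ^ 2 = Complex.exp b / b ^ 2 ∧
    Complex.exp b / b ^ 2 = Complex.exp (-(a + b)) / (a + b) ^ 2}


section KdvAbstract

variable {X : Type*} [NormedAddCommGroup X] [NormedSpace ℝ X]

/-- Abstract solution curves: `du = v` and `u = G v` on `[a,b]`. -/
structure KdvSol (G : X →L[ℝ] X) (a b : ℝ) (u v : ℝ → X) : Prop where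
  cont : Continuous v
  der : ∀ t, HasDerivAt u (v t) t
  eq : ∀ t ∈ Icc a b, u t = G (v t)

lemma KdvSol.contu {G : X →L[ℝ] X} {a b : ℝ} {u v : ℝ → X} (h : KdvSol G a b u v) :
    Continuous u :=
  continuous_iff_continuousAt.2 fun t => (h.der t).continuousAt

lemma KdvSol.sub {G : X →L[ℝ] X} {a b : ℝ} {u v u' v' : ℝ → X} (h : KdvSol G a b u v)
    (h' : KdvSol G a b u' v') : KdvSol G a b (fun t => u t - u' t) (fun t => v t - v' t) :=
  ⟨h.cont.sub h'.cont, fun t => (h.der t).sub (h'.der t),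
    fun t ht => by simp [h.eq t ht, h'.eq t ht]⟩

lemma KdvSol.smul {G : X →L[ℝ] X} {a b : ℝ} {u v : ℝ → X} (h : KdvSol G a b u v)
    (c : ℝ) : KdvSol G a b (fun t => c • u t) (fun t => c • v t) :=
  ⟨h.cont.const_smul c, fun t => (h.der t).const_smul c,
    fun t ht => by simp [h.eq t ht]⟩

lemma KdvSol.sum {ι : Type*} (s : Finset ι) (c : ι → ℝ) {G : X →L[ℝ] X} {a b : ℝ}
    {u v : ι → ℝ → X} (h : ∀ i, KdvSol G a b (u i) (v i)) :
    KdvSol G a b (fun t => ∑ i ∈ s, c i • u i t) (fun t => ∑ i ∈ s, c i • v i t) :=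
  ⟨continuous_finsetSum _ fun i _ => (h i).cont.const_smul _,
    fun t => HasDerivAt.fun_sum fun i _ => ((h i).der t).const_smul _,
    fun t ht => by simp [fun i => (h i).eq t ht]⟩

/-- Cauchy–Schwarz on an interval. -/
lemma kdv_cs {y : ℝ → ℝ} (hy : Continuous y) {s t : ℝ} (hst : s ≤ t) :
    (∫ r in s..t, y r) ^ 2 ≤ (t - s) * ∫ r in s..t, (y r) ^ 2 := by
  rcases hst.eq_or_lt with rfl | h
  · simp
  have hd : 0 < t - s := by linarith
  set c := (∫ r in s..t, y r) / (t - s) with hc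
  have h1 : 0 ≤ ∫ r in s..t, (y r - c) ^ 2 :=
    intervalIntegral.integral_nonneg hst fun r _ => sq_nonneg _
  have h2 : ∫ r in s..t, (y r - c) ^ 2
      = (∫ r in s..t, (y r) ^ 2) - 2 * c * (∫ r in s..t, y r) + c ^ 2 * (t - s) := by
    have : ∀ r, (y r - c) ^ 2 = (y r) ^ 2 - 2 * c * y r + c ^ 2 := fun r => by ring
    simp only [this]
    rw [intervalIntegral.integral_add, intervalIntegral.integral_sub,
      intervalIntegral.integral_const_mul]
    · simp; ring
    all_goals exact Continuous.intervalIntegrable (by fun_prop) _ _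
  have h3 : (∫ r in s..t, y r) = c * (t - s) := by rw [hc]; field_simp
  rw [h2, h3] at h1
  rw [h3]
  nlinarith

variable [CompleteSpace X]

/-- derivative of a convolution-type integral -/
lemma kdv_conv_der {ρ : ℝ → ℝ} (hρ : ContDiff ℝ 1 ρ) (hc : HasCompactSupport ρ)
    {F : ℝ → X} (hF : Continuous F) (a b t : ℝ) :
    HasDerivAt (fun t => ∫ s in a..b, ρ (t - s) • F s) (∫ s in a..b, deriv ρ (t - s) • F s) t := by
  have hd : Continuous (deriv ρ) := hρ.continuous_deriv le_rfl
  obtain ⟨C, hC⟩ := hc.deriv.exists_bound_of_continuous hd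
  have hρc := hρ.continuous
  refine (intervalIntegral.hasDerivAt_integral_of_dominated_loc_of_deriv_le
    (F := fun t s => ρ (t - s) • F s) (F' := fun t s => deriv ρ (t - s) • F s)
    (bound := fun s => C * ‖F s‖) (s := univ) Filter.univ_mem ?_ ?_ ?_ ?_ ?_ ?_).2
  · exact Filter.Eventually.of_forall fun x => Continuous.aestronglyMeasurable (by fun_prop)
  · exact Continuous.intervalIntegrable (by fun_prop) _ _
  · exact Continuous.aestronglyMeasurable (by fun_prop)
  · refine Filter.Eventually.of_forall fun s _ x _ => ?_
    rw [norm_smul]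
    exact mul_le_mul_of_nonneg_right (hC _) (norm_nonneg _)
  · exact Continuous.intervalIntegrable (by fun_prop) _ _
  · refine Filter.Eventually.of_forall fun s _ x _ => ?_
    have h1 : HasDerivAt ρ (deriv ρ (x - s)) (x - s) :=
      (hρ.differentiable one_ne_zero _).hasDerivAt
    exact (h1.comp_sub_const x s).smul_const (F s)

/-- integration by parts against a test function vanishing at the ends -/
lemma kdv_parts {Y : Type*} [NormedAddCommGroup Y] [NormedSpace ℝ Y] [CompleteSpace Y]
    {ρ : ℝ → ℝ} (hρ : ContDiff ℝ 1 ρ) {F F' : ℝ → Y} (hF' : Continuous F')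
    (hF : ∀ t, HasDerivAt F (F' t) t) {a b t : ℝ} (h1 : ρ (t - a) = 0) (h2 : ρ (t - b) = 0) :
    ∫ s in a..b, deriv ρ (t - s) • F s = ∫ s in a..b, ρ (t - s) • F' s := by
  have hd : Continuous (deriv ρ) := hρ.continuous_deriv le_rfl
  have hρc := hρ.continuous
  have hFc : Continuous F := continuous_iff_continuousAt.2 fun t => (hF t).continuousAt
  have key : ∫ s in a..b, (ρ (t - s) • F' s + (-(deriv ρ (t - s))) • F s) = 0 := by
    rw [intervalIntegral.integral_eq_sub_of_hasDerivAt (f := fun s => ρ (t - s) • F s)]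
    · simp [h1, h2]
    · intro s _
      have h1 : HasDerivAt ρ (deriv ρ (t - s)) (t - s) :=
        (hρ.differentiable one_ne_zero _).hasDerivAt
      exact (h1.comp_const_sub t s).smul (hF s)
    · exact Continuous.intervalIntegrable (by fun_prop) _ _
  rw [intervalIntegral.integral_add] at key
  · simp only [neg_smul, intervalIntegral.integral_neg] at key
    exact (add_neg_eq_zero.1 key).symm
  all_goals exact Continuous.intervalIntegrable (by fun_prop) _ _

/-- Unique continuation for smooth curves. -/
lemma kdv_uc (G : X →L[ℝ] X) (O : X →L[ℝ] ℝ) (e : X → ℝ) {a b : ℝ}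
    (H1 : ∃ (n : ℕ) (m : Fin n → (X →L[ℝ] ℝ)) (τ : Fin n → ℝ) (C : ℝ), 0 < C ∧
      (∀ j, τ j ∈ Icc a b) ∧ ∀ u v, KdvSol G a b u v →
        e (u b) ≤ C * ((∑ j, (m j (G (u (τ j)))) ^ 2) + ∫ t in a..b, (O (v t)) ^ 2))
    (H4 : ∀ (φ : ℕ → X) (P : Polynomial ℝ), (∀ k, φ k = G (φ (k + 1))) → (∀ k, O (φ k) = 0) →
      P ≠ 0 → (P.sum fun k c => c • φ k) = 0 → φ 0 = 0)
    (H5 : ∀ w, e w ≤ 0 → w = 0) (hab : a ≤ b)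
    (u : ℕ → ℝ → X) (hu : ∀ k t, HasDerivAt (u k) (u (k + 1) t) t)
    (hG : ∀ k, ∀ t ∈ Icc a b, u k t = G (u (k + 1) t))
    (hO : ∀ k, ∀ t ∈ Icc a b, O (u k t) = 0) : u 0 b = 0 := by
  obtain ⟨n, m, τ, C, hC, hτ, H⟩ := H1
  have hsol : ∀ k, KdvSol G a b (u k) (u (k + 1)) := fun k =>
    ⟨continuous_iff_continuousAt.2 fun t => (hu (k + 1) t).continuousAt, hu k, hG k⟩
  let x : Fin (n + 1) → (Fin n → ℝ) := fun k j => m j (G (u k (τ j)))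
  have hx : ¬ LinearIndependent ℝ x := fun h => by
    have := h.fintype_card_le_finrank
    simp at this
  rw [Fintype.not_linearIndependent_iff] at hx
  obtain ⟨c, hc, i, hi⟩ := hx
  have hs := H _ _ (KdvSol.sum Finset.univ c (u := fun k : Fin (n + 1) => u k)
    (v := fun k : Fin (n + 1) => u (k + 1)) (fun k => hsol k))
  have e1 : ∀ j, m j (G (∑ k, c k • u (k : ℕ) (τ j))) = 0 := fun j => by
    have := congrFun hc j
    simpa [x] using this
  have e2 : ∫ t in a..b, (O (∑ k, c k • u ((k : ℕ) + 1) t)) ^ 2 = 0 := by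
    have : ∫ t in a..b, (O (∑ k, c k • u ((k : ℕ) + 1) t)) ^ 2 = ∫ t in a..b, (0 : ℝ) := by
      refine intervalIntegral.integral_congr fun t ht => ?_
      rw [uIcc_of_le hab] at ht
      simp [hO _ t ht]
    simpa using this
  have hw := H5 _ (hs.trans_eq (by simp only [e1, e2]; simp))
  let P : Polynomial ℝ := ∑ k : Fin (n + 1), Polynomial.monomial k (c k)
  have hcoef : ∀ k : Fin (n + 1), P.coeff k = c k := fun k => by
    simp only [P, Polynomial.finsetSum_coeff, Polynomial.coeff_monomial]
    rw [Finset.sum_eq_single k]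
    · simp
    · intro l _ hl
      rw [if_neg]
      exact fun h => hl (Fin.ext h)
    · simp
  refine H4 (fun k => u k b) P (fun k => hG k b ⟨hab, le_rfl⟩) (fun k => hO k b ⟨hab, le_rfl⟩)
    (fun h => hi ?_) ?_
  · rw [← hcoef i, h]; simp
  · have hdeg : P.natDegree < n + 1 := by
      exact Nat.lt_succ_of_le (Polynomial.natDegree_sum_le_of_forall_le _ _ fun k _ =>
        (Polynomial.natDegree_monomial_le _).trans k.is_le)
    rw [Polynomial.sum_over_range' _ (fun k => by simp) (n + 1) hdeg, Finset.sum_range]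
    simpa only [hcoef] using hw

/-- A weak limit with vanishing observation vanishes. -/
lemma kdv_limit_zero (G : X →L[ℝ] X) (O : X →L[ℝ] ℝ) (e : X → ℝ) {a b : ℝ} (hab : a < b)
    (H1 : ∀ a b : ℝ, a < b → ∃ (n : ℕ) (m : Fin n → (X →L[ℝ] ℝ)) (τ : Fin n → ℝ) (C : ℝ), 0 < C ∧
      (∀ j, τ j ∈ Icc a b) ∧ ∀ u v, KdvSol G a b u v →
        e (u b) ≤ C * ((∑ j, (m j (G (u (τ j)))) ^ 2) + ∫ t in a..b, (O (v t)) ^ 2))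
    (H4 : ∀ (φ : ℕ → X) (P : Polynomial ℝ), (∀ k, φ k = G (φ (k + 1))) → (∀ k, O (φ k) = 0) →
      P ≠ 0 → (P.sum fun k c => c • φ k) = 0 → φ 0 = 0)
    (H5 : ∀ w, e w ≤ 0 → w = 0) (F : ℝ → X) (hF : Continuous F)
    (L1 : ∀ ρ : ℝ → ℝ, ContDiff ℝ (↑(⊤ : ℕ∞)) ρ → ∀ t, ρ (t - a) = 0 → ρ (t - b) = 0 →
      ∫ s in a..b, ρ (t - s) • F s = G (∫ s in a..b, deriv ρ (t - s) • F s))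
    (L2 : ∀ ρ : ℝ → ℝ, ContDiff ℝ (↑(⊤ : ℕ∞)) ρ → ∀ t, ρ (t - a) = 0 → ρ (t - b) = 0 →
      deriv ρ (t - a) = 0 → deriv ρ (t - b) = 0 →
      O (∫ s in a..b, deriv (deriv ρ) (t - s) • F s) = 0) :
    ∀ t ∈ Icc a b, F t = 0 := by
  have step : ∀ ε, 0 < ε → ε < b - a → ∀ r ∈ Ioo 0 (b - a - ε), F (b - r) = 0 := by
    intro ε hε hεb
    have hFc : Continuous fun r => F (b - r) := by fun_prop
    have hae := isOpen_Ioo.ae_eq_zero_of_integral_contDiff_smul_eq_zero (μ := volume)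
      (f := fun r => F (b - r)) (U := Ioo 0 (b - a - ε))
      (hFc.locallyIntegrable.locallyIntegrableOn _) ?_
    · have h2 : (fun r => F (b - r)) =ᵐ[volume.restrict (Ioo 0 (b - a - ε))] fun _ => (0 : X) := by
        rw [Filter.EventuallyEq, ae_restrict_iff' measurableSet_Ioo]
        exact hae
      have h3 := Measure.eqOn_of_ae_eq h2 hFc.continuousOn continuousOn_const
        (by rw [interior_Ioo]; exact subset_closure)
      exact fun r hr => h3 hr
    · intro ρ hρ hcs hts
      have hk : ∀ k, ContDiff ℝ (↑(⊤ : ℕ∞)) (deriv^[k] ρ) ∧ HasCompactSupport (deriv^[k] ρ) ∧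
          tsupport (deriv^[k] ρ) ⊆ Ioo 0 (b - a - ε) := by
        intro k
        induction k with
        | zero => exact ⟨hρ, hcs, hts⟩
        | succ k ih =>
          rw [Function.iterate_succ_apply']
          refine ⟨?_, ih.2.1.deriv, Subset.trans tsupport_deriv_subset ih.2.2⟩
          exact ((contDiff_infty_iff_deriv (𝕜 := ℝ)).1 ih.1).2
      have hz : ∀ k, ∀ t ∈ Icc (b - ε) b, deriv^[k] ρ (t - a) = 0 ∧ deriv^[k] ρ (t - b) = 0 := by
        intro k t ht
        constructor
        · refine image_eq_zero_of_notMem_tsupport fun h => ?_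
          have := (hk k).2.2 h
          linarith [this.2, ht.1]
        · refine image_eq_zero_of_notMem_tsupport fun h => ?_
          have := (hk k).2.2 h
          linarith [this.1, ht.2]
      have hG : ∀ k, ∀ t ∈ Icc (b - ε) b, ∫ s in a..b, deriv^[k] ρ (t - s) • F s
          = G (∫ s in a..b, deriv^[k + 1] ρ (t - s) • F s) := by
        intro k t ht
        rw [Function.iterate_succ_apply']
        exact L1 _ (hk k).1 t (hz k t ht).1 (hz k t ht).2
      have hbI : b ∈ Icc (b - ε) b := ⟨by linarith, le_rfl⟩
      have h0 := kdv_uc G O e (H1 (b - ε) b (by linarith)) H4 H5 (by linarith)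
        (fun k t => ∫ s in a..b, deriv^[k + 2] ρ (t - s) • F s)
        (fun k t => by
          have := kdv_conv_der ((hk (k + 2)).1.of_le (by exact_mod_cast le_top)) (hk (k + 2)).2.1 hF a b t
          rw [← Function.iterate_succ_apply' (f := deriv)] at this
          exact this)
        (fun k t ht => hG (k + 2) t ht)
        (fun k t ht => by
          have := L2 (deriv^[k] ρ) (hk k).1 t (hz k t ht).1 (hz k t ht).2
            (by have := (hz (k + 1) t ht).1; rwa [Function.iterate_succ_apply'] at this)
            (by have := (hz (k + 1) t ht).2; rwa [Function.iterate_succ_apply'] at this)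
          rw [← Function.iterate_succ_apply' (f := deriv),
            ← Function.iterate_succ_apply' (f := deriv)] at this
          exact this)
      have h1 := hG 1 b hbI
      have h00 := hG 0 b hbI
      simp only [zero_add] at h0 h00
      rw [h0, map_zero] at h1
      rw [h1, map_zero] at h00
      simp only [Function.iterate_zero, id] at h00
      have h5 := intervalIntegral.integral_comp_sub_left (a := a) (b := b)
        (fun r => ρ r • F (b - r)) b
      simp only [sub_sub_cancel, sub_self] at h5
      rw [h00] at h5
      rw [h5, intervalIntegral.integral_eq_integral_of_support_subset]
      intro r hr
      have : r ∈ tsupport ρ := subset_tsupport _ fun h => hr (by simp [h])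
      have := hts this
      exact ⟨this.1, by linarith [this.2]⟩
  have hIoo : EqOn F (fun _ => 0) (Ioo a b) := by
    intro t ht
    have := step ((t - a) / 2) (by linarith [ht.1]) (by linarith [ht.1, ht.2]) (b - t)
      ⟨by linarith [ht.2], by linarith [ht.1]⟩
    simpa using this
  have hcl := hIoo.closure hF continuous_const
  rw [closure_Ioo hab.ne] at hcl
  exact hcl

/-- Abstract compactness–uniqueness argument. -/
lemma kdv_abstract (G : X →L[ℝ] X) (O : X →L[ℝ] ℝ) (e : X → ℝ)
    (H1 : ∀ a b : ℝ, a < b → ∃ (n : ℕ) (m : Fin n → (X →L[ℝ] ℝ)) (τ : Fin n → ℝ) (C : ℝ), 0 < C ∧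
      (∀ j, τ j ∈ Icc a b) ∧ ∀ u v, KdvSol G a b u v →
        e (u b) ≤ C * ((∑ j, (m j (G (u (τ j)))) ^ 2) + ∫ t in a..b, (O (v t)) ^ 2))
    (H2 : ∀ (a b : ℝ) (u v), KdvSol G a b u v → ∀ t ∈ Icc a b, e (u t) ≤ e (u b))
    (H3 : ∃ K : ℝ, 0 < K ∧ ∀ w, ‖G w‖ ^ 2 ≤ K * e w)
    (He : ∀ (c : ℝ) w, e (c • w) = c ^ 2 * e w)
    (H4 : ∀ (φ : ℕ → X) (P : Polynomial ℝ), (∀ k, φ k = G (φ (k + 1))) → (∀ k, O (φ k) = 0) →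
      P ≠ 0 → (P.sum fun k c => c • φ k) = 0 → φ 0 = 0)
    (H5 : ∀ w, e w ≤ 0 → w = 0) {a b : ℝ} (hab : a < b) :
    ∃ C : ℝ, 0 < C ∧ ∀ u v, KdvSol G a b u v →
      e (u b) ≤ C * ∫ t in a..b, (O (v t)) ^ 2 := by
  by_contra! hcon
  have hex : ∀ n : ℕ, ∃ u v, KdvSol G a b u v ∧ e (u b) = 1 ∧
      ∫ t in a..b, (O (v t)) ^ 2 ≤ 1 / ((n : ℝ) + 1) := by
    intro n
    obtain ⟨u, v, hs, hlt⟩ := hcon ((n : ℝ) + 1) (by positivity)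
    have hI : 0 ≤ ∫ t in a..b, (O (v t)) ^ 2 :=
      intervalIntegral.integral_nonneg hab.le fun _ _ => sq_nonneg _
    have hn : (0 : ℝ) < (n : ℝ) + 1 := by positivity
    have hpos : 0 < e (u b) := lt_of_le_of_lt (by positivity) hlt
    have hsq : (1 / Real.sqrt (e (u b))) ^ 2 = 1 / e (u b) := by
      rw [div_pow, Real.sq_sqrt hpos.le, one_pow]
    refine ⟨_, _, hs.smul (1 / Real.sqrt (e (u b))), ?_, ?_⟩
    · rw [He, hsq]; field_simp
    · simp only [map_smul, smul_eq_mul, mul_pow, hsq]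
      rw [intervalIntegral.integral_const_mul]
      rw [div_mul_eq_mul_div, one_mul, div_le_div_iff₀ hpos hn]
      linarith
  choose u v hs he hO using hex
  obtain ⟨n, m, τ, C, hC, hτ, H⟩ := H1 a b hab
  obtain ⟨K, hK, hGK⟩ := H3
  have hbd : ∀ k, ∀ t ∈ Icc a b, ‖G (u k t)‖ ≤ Real.sqrt K := by
    intro k t ht
    refine Real.le_sqrt_of_sq_le ((hGK _).trans ?_)
    have := H2 a b _ _ (hs k) t ht
    rw [he k] at this
    nlinarith
  obtain ⟨l, -, φ, hφ, hl⟩ := (isCompact_univ_pi (fun j : Fin n =>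
    isCompact_Icc (a := -(‖m j‖ * Real.sqrt K)) (b := ‖m j‖ * Real.sqrt K))).tendsto_subseq
    (x := fun k j => m j (G (u k (τ j)))) (fun k j _ => by
      refine abs_le.1 ?_
      exact ((m j).le_opNorm _).trans
        (mul_le_mul_of_nonneg_left (hbd k _ (hτ j)) (norm_nonneg _)))
  have hlj : ∀ j, Filter.Tendsto (fun k => m j (G (u (φ k) (τ j)))) Filter.atTop (nhds (l j)) :=
    fun j => (tendsto_pi_nhds.1 hl) j
  have hOint : ∀ k, IntervalIntegrable (fun t => (O (v k t)) ^ 2) volume a b := fun k => by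
    have := (hs k).cont
    exact Continuous.intervalIntegrable (by fun_prop) _ _
  have hdiff : ∀ i k : ℕ, e (u i b - u k b) ≤ C * ((∑ j, (m j (G (u i (τ j))) -
      m j (G (u k (τ j)))) ^ 2) + (2 * (1 / ((i : ℝ) + 1)) + 2 * (1 / ((k : ℝ) + 1)))) := by
    intro i k
    have h1 := H _ _ ((hs i).sub (hs k))
    refine h1.trans ?_
    simp only [map_sub]
    gcongr
    calc ∫ t in a..b, (O (v i t) - O (v k t)) ^ 2
        ≤ ∫ t in a..b, (2 * (O (v i t)) ^ 2 + 2 * (O (v k t)) ^ 2) := by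
          refine intervalIntegral.integral_mono_on hab.le ?_ ?_ ?_
          · have := (hs i).cont
            have := (hs k).cont
            exact Continuous.intervalIntegrable (by fun_prop) _ _
          · exact ((hOint i).const_mul 2).add ((hOint k).const_mul 2)
          · intro t _
            nlinarith [sq_nonneg (O (v i t) + O (v k t))]
      _ = 2 * (∫ t in a..b, (O (v i t)) ^ 2) + 2 * ∫ t in a..b, (O (v k t)) ^ 2 := by
          rw [intervalIntegral.integral_add ((hOint i).const_mul 2) ((hOint k).const_mul 2),
            intervalIntegral.integral_const_mul, intervalIntegral.integral_const_mul]
      _ ≤ _ := by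
          have := hO i
          have := hO k
          linarith
  have hφt : Filter.Tendsto φ Filter.atTop Filter.atTop := hφ.tendsto_atTop
  have hinv : Filter.Tendsto (fun k => 1 / ((φ k : ℝ) + 1)) Filter.atTop (nhds 0) :=
    (tendsto_one_div_add_atTop_nhds_zero_nat (𝕜 := ℝ)).comp hφt
  let Φ : ℕ → C(Icc a b, X) := fun k => ⟨fun t => G (u (φ k) t), by
    have := (hs (φ k)).contu
    fun_prop⟩
  have hcau : CauchySeq Φ := by
    rw [cauchySeq_iff_tendsto_dist_atTop_0]
    have hR : Filter.Tendsto (fun p : ℕ × ℕ => Real.sqrt (K * (C * ((∑ j,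
        (m j (G (u (φ p.1) (τ j))) - m j (G (u (φ p.2) (τ j)))) ^ 2) +
        (2 * (1 / ((φ p.1 : ℝ) + 1)) + 2 * (1 / ((φ p.2 : ℝ) + 1))))))) Filter.atTop (nhds 0) := by
      have hfst : Filter.Tendsto (fun p : ℕ × ℕ => p.1) Filter.atTop Filter.atTop := by
        rw [← Filter.prod_atTop_atTop_eq]; exact Filter.tendsto_fst
      have hsnd : Filter.Tendsto (fun p : ℕ × ℕ => p.2) Filter.atTop Filter.atTop := by
        rw [← Filter.prod_atTop_atTop_eq]; exact Filter.tendsto_snd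
      have h1 : Filter.Tendsto (fun p : ℕ × ℕ => K * (C * ((∑ j,
        (m j (G (u (φ p.1) (τ j))) - m j (G (u (φ p.2) (τ j)))) ^ 2) +
        (2 * (1 / ((φ p.1 : ℝ) + 1)) + 2 * (1 / ((φ p.2 : ℝ) + 1)))))) Filter.atTop
          (nhds (K * (C * ((∑ j, (l j - l j) ^ 2) + (2 * 0 + 2 * 0))))) := by
        refine Filter.Tendsto.const_mul _ (Filter.Tendsto.const_mul _ (Filter.Tendsto.add ?_ ?_))
        · exact tendsto_finsetSum _ fun j _ =>
            (((hlj j).comp hfst).sub ((hlj j).comp hsnd)).pow 2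
        · exact ((hinv.comp hfst).const_mul 2).add ((hinv.comp hsnd).const_mul 2)
      have h2 := h1.sqrt
      simpa using h2
    refine squeeze_zero (fun _ => dist_nonneg) (fun p => ?_) hR
    rw [ContinuousMap.dist_le (Real.sqrt_nonneg _)]
    intro t
    rw [dist_eq_norm]
    refine Real.le_sqrt_of_sq_le ?_
    change ‖G (u (φ p.1) t) - G (u (φ p.2) t)‖ ^ 2 ≤ _
    rw [← map_sub]
    refine (hGK _).trans (mul_le_mul_of_nonneg_left ?_ hK.le)
    exact (H2 a b _ _ ((hs (φ p.1)).sub (hs (φ p.2))) t t.2).trans (hdiff _ _)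
  obtain ⟨F0, hF0⟩ := cauchySeq_tendsto_of_complete hcau
  let F : ℝ → X := fun t => F0 (projIcc a b hab.le t)
  have hF : Continuous F := F0.continuous.comp continuous_projIcc
  have hδ : Filter.Tendsto (fun k => ‖Φ k - F0‖) Filter.atTop (nhds 0) :=
    (tendsto_iff_norm_sub_tendsto_zero).1 hF0
  have hunif : ∀ k, ∀ t ∈ Icc a b, ‖G (u (φ k) t) - F t‖ ≤ ‖Φ k - F0‖ := by
    intro k t ht
    have := (Φ k - F0).norm_coe_le_norm ⟨t, ht⟩
    simpa [Φ, F, projIcc_of_mem hab.le ht] using this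
  have hlim : ∀ c : ℝ → ℝ, Continuous c → Filter.Tendsto
      (fun k => ∫ s in a..b, c s • G (u (φ k) s)) Filter.atTop
      (nhds (∫ s in a..b, c s • F s)) := by
    intro c hc
    rw [tendsto_iff_norm_sub_tendsto_zero]
    have h1 : Filter.Tendsto (fun k => (∫ s in a..b, |c s|) * ‖Φ k - F0‖) Filter.atTop (nhds 0) := by
      simpa using hδ.const_mul (∫ s in a..b, |c s|)
    refine squeeze_zero (fun _ => norm_nonneg _) (fun k => ?_) h1
    have hcu := (hs (φ k)).contu
    rw [← intervalIntegral.integral_sub, ← intervalIntegral.integral_mul_const]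
    · refine intervalIntegral.norm_integral_le_of_norm_le hab.le ?_ ?_
      · refine Filter.Eventually.of_forall fun s hs => ?_
        rw [← smul_sub, norm_smul, Real.norm_eq_abs]
        exact mul_le_mul_of_nonneg_left (hunif k s ⟨hs.1.le, hs.2⟩) (abs_nonneg _)
      · exact Continuous.intervalIntegrable (by fun_prop) _ _
    all_goals exact Continuous.intervalIntegrable (by fun_prop) _ _
  have hGd : ∀ k t, HasDerivAt (fun s => G (u k s)) (G (v k t)) t := fun k t =>
    G.hasFDerivAt.comp_hasDerivAt t ((hs k).der t)
  have hzero := kdv_limit_zero G O e hab H1 H4 H5 F hF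
    (by
      intro ρ hρ t h1 h2
      have hρ1 : ContDiff ℝ 1 ρ := hρ.of_le (by exact_mod_cast le_top)
      have hd : Continuous (deriv ρ) := hρ1.continuous_deriv le_rfl
      have hρc := hρ.continuous
      have t1 := hlim (fun s => ρ (t - s)) (by fun_prop)
      have t2 := (G.continuous.tendsto _).comp (hlim (fun s => deriv ρ (t - s)) (by fun_prop))
      refine tendsto_nhds_unique t1 (t2.congr fun k => ?_)
      have hcu := (hs (φ k)).contu
      have hcv := (hs (φ k)).cont
      simp only [Function.comp]
      rw [← ContinuousLinearMap.intervalIntegral_comp_comm]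
      · simp only [map_smul]
        rw [kdv_parts hρ1 (F := fun s => G (G (u (φ k) s))) (F' := fun s => G (G (v (φ k) s))) (by fun_prop)
          (fun s => G.hasFDerivAt.comp_hasDerivAt s (hGd (φ k) s)) h1 h2]
        refine intervalIntegral.integral_congr fun s hs' => ?_
        rw [uIcc_of_le hab.le] at hs'
        rw [← (hs (φ k)).eq s hs']
      · exact Continuous.intervalIntegrable (by fun_prop) _ _)
    (by
      intro ρ hρ t h1 h2 h3 h4
      have hρ1 : ContDiff ℝ 1 ρ := hρ.of_le (by exact_mod_cast le_top)
      have hρd : ContDiff ℝ (↑(⊤ : ℕ∞)) (deriv ρ) :=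
        ((contDiff_infty_iff_deriv (𝕜 := ℝ)).1 hρ).2
      have hρd1 : ContDiff ℝ 1 (deriv ρ) := hρd.of_le (by exact_mod_cast le_top)
      have hdd : Continuous (deriv (deriv ρ)) := hρd1.continuous_deriv le_rfl
      have hd : Continuous (deriv ρ) := hρ1.continuous_deriv le_rfl
      have hρc := hρ.continuous
      have t2 := (O.continuous.tendsto _).comp
        (hlim (fun s => deriv (deriv ρ) (t - s)) (by fun_prop))
      obtain ⟨R, hR⟩ := (isCompact_Icc (a := a) (b := b)).exists_bound_of_continuousOn
        (f := fun s => ρ (t - s)) (by fun_prop)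
      refine tendsto_nhds_unique t2 ?_
      have t3 : Filter.Tendsto (fun k => Real.sqrt ((b - a) * (R ^ 2 * (1 / ((φ k : ℝ) + 1)))))
          Filter.atTop (nhds 0) := by
        simpa using ((hinv.const_mul (R ^ 2)).const_mul (b - a)).sqrt
      refine squeeze_zero_norm (fun k => ?_) t3
      have hcu := (hs (φ k)).contu
      have hcv := (hs (φ k)).cont
      simp only [Function.comp]
      rw [← ContinuousLinearMap.intervalIntegral_comp_comm]
      · simp only [map_smul]
        rw [kdv_parts hρd1 (F := fun s => O (G (u (φ k) s))) (F' := fun s => O (G (v (φ k) s))) (by fun_prop)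
          (fun s => O.hasFDerivAt.comp_hasDerivAt s (hGd (φ k) s)) h3 h4]
        have e1 : ∫ s in a..b, deriv ρ (t - s) • O (G (v (φ k) s))
            = ∫ s in a..b, deriv ρ (t - s) • O (u (φ k) s) := by
          refine intervalIntegral.integral_congr fun s hs' => ?_
          rw [uIcc_of_le hab.le] at hs'
          rw [← (hs (φ k)).eq s hs']
        rw [e1, kdv_parts hρ1 (F := fun s => O (u (φ k) s)) (F' := fun s => O (v (φ k) s)) (by fun_prop)
          (fun s => O.hasFDerivAt.comp_hasDerivAt s ((hs (φ k)).der s)) h1 h2]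
        rw [Real.norm_eq_abs]
        refine Real.abs_le_sqrt ((kdv_cs (by fun_prop) hab.le).trans ?_)
        refine mul_le_mul_of_nonneg_left ?_ (by linarith)
        calc ∫ s in a..b, (ρ (t - s) • O (v (φ k) s)) ^ 2
            ≤ ∫ s in a..b, R ^ 2 * (O (v (φ k) s)) ^ 2 := by
              refine intervalIntegral.integral_mono_on hab.le ?_ ?_ ?_
              · exact Continuous.intervalIntegrable (by fun_prop) _ _
              · exact Continuous.intervalIntegrable (by fun_prop) _ _
              · intro s hs'
                rw [smul_eq_mul, mul_pow]
                refine mul_le_mul_of_nonneg_right ?_ (sq_nonneg _)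
                have := hR s hs'
                rw [Real.norm_eq_abs] at this
                exact sq_le_sq' (abs_le.1 this).1 (abs_le.1 this).2
          _ = R ^ 2 * ∫ s in a..b, (O (v (φ k) s)) ^ 2 := intervalIntegral.integral_const_mul _ _
          _ ≤ _ := mul_le_mul_of_nonneg_left (hO _) (sq_nonneg _)
      · exact Continuous.intervalIntegrable (by fun_prop) _ _)
  have hG0 : ∀ j, Filter.Tendsto (fun k => m j (G (u (φ k) (τ j)))) Filter.atTop (nhds 0) := by
    intro j
    have h1 : Filter.Tendsto (fun k => G (u (φ k) (τ j))) Filter.atTop (nhds 0) := by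
      refine squeeze_zero_norm (fun k => ?_) hδ
      simpa [hzero _ (hτ j)] using hunif k (τ j) (hτ j)
    simpa [Function.comp_def] using ((m j).continuous.tendsto _).comp h1
  have hfin : Filter.Tendsto (fun k => C * ((∑ j, (m j (G (u (φ k) (τ j)))) ^ 2) +
      1 / ((φ k : ℝ) + 1))) Filter.atTop (nhds (C * ((∑ j : Fin n, (0 : ℝ) ^ 2) + 0))) :=
    ((tendsto_finsetSum _ fun j _ => (hG0 j).pow 2).add hinv).const_mul C
  have h1le : (1 : ℝ) ≤ C * ((∑ j : Fin n, (0 : ℝ) ^ 2) + 0) :=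
    ge_of_tendsto' hfin fun k => by
      have := H _ _ (hs (φ k))
      rw [he] at this
      refine this.trans (mul_le_mul_of_nonneg_left ?_ hC.le)
      linarith [hO (φ k)]
  norm_num at h1le

end KdvAbstract

section KdvConcrete

/-- the state space -/
abbrev KX (L : ℝ) := C(Icc (0 : ℝ) L, ℝ)

variable {L : ℝ} (hL : 0 < L)

/-- extension of an element of the state space to the line -/
noncomputable def kev (w : KX L) (x : ℝ) : ℝ := w (projIcc 0 L hL.le x)

lemma kev_cont (w : KX L) : Continuous (kev hL w) := w.continuous.comp continuous_projIcc

lemma kev_mem (w : KX L) {x : ℝ} (hx : x ∈ Icc 0 L) : kev hL w x = w ⟨x, hx⟩ := by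
  simp [kev, projIcc_of_mem hL.le hx]

lemma kev_add (w w' : KX L) (x : ℝ) : kev hL (w + w') x = kev hL w x + kev hL w' x := rfl
lemma kev_mul (w w' : KX L) (x : ℝ) : kev hL (w * w') x = kev hL w x * kev hL w' x := rfl
lemma kev_smul (c : ℝ) (w : KX L) (x : ℝ) : kev hL (c • w) x = c * kev hL w x := rfl
lemma kev_le (w : KX L) (x : ℝ) : |kev hL w x| ≤ ‖w‖ := w.norm_coe_le_norm _

lemma kint (f : ℝ → ℝ) (hf : Continuous f) (a b : ℝ) : IntervalIntegrable f volume a b :=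
  hf.intervalIntegrable _ _

/-- `W w z = ∫_z^L w` -/
noncomputable def kW (w : KX L) (z : ℝ) : ℝ := ∫ y in z..L, kev hL w y

lemma kW_der (w : KX L) (x : ℝ) : HasDerivAt (kW hL w) (-(kev hL w x)) x :=
  intervalIntegral.integral_hasDerivAt_left (kint _ (kev_cont hL w) _ _)
    ((kev_cont hL w).stronglyMeasurableAtFilter _ _) (kev_cont hL w).continuousAt

lemma kW_cont (w : KX L) : Continuous (kW hL w) :=
  continuous_iff_continuousAt.2 fun x => (kW_der hL w x).continuousAt

lemma kW_add (w w' : KX L) (x : ℝ) : kW hL (w + w') x = kW hL w x + kW hL w' x := by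
  simp only [kW, kev_add]
  exact intervalIntegral.integral_add (kint _ (kev_cont hL w) _ _) (kint _ (kev_cont hL w') _ _)

lemma kW_smul (c : ℝ) (w : KX L) (x : ℝ) : kW hL (c • w) x = c * kW hL w x := by
  simp only [kW, kev_smul]
  exact intervalIntegral.integral_const_mul _ _

/-- `∫_0^x cos z W z` -/
noncomputable def kA (w : KX L) (x : ℝ) : ℝ := ∫ z in (0 : ℝ)..x, Real.cos z * kW hL w z
/-- `∫_0^x sin z W z` -/
noncomputable def kB (w : KX L) (x : ℝ) : ℝ := ∫ z in (0 : ℝ)..x, Real.sin z * kW hL w z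

lemma kcW (w : KX L) : Continuous fun z => Real.cos z * kW hL w z :=
  Real.continuous_cos.mul (kW_cont hL w)
lemma ksW (w : KX L) : Continuous fun z => Real.sin z * kW hL w z :=
  Real.continuous_sin.mul (kW_cont hL w)

lemma kA_der (w : KX L) (x : ℝ) : HasDerivAt (kA hL w) (Real.cos x * kW hL w x) x :=
  intervalIntegral.integral_hasDerivAt_right (kint _ (kcW hL w) _ _)
    ((kcW hL w).stronglyMeasurableAtFilter _ _) (kcW hL w).continuousAt
lemma kB_der (w : KX L) (x : ℝ) : HasDerivAt (kB hL w) (Real.sin x * kW hL w x) x :=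
  intervalIntegral.integral_hasDerivAt_right (kint _ (ksW hL w) _ _)
    ((ksW hL w).stronglyMeasurableAtFilter _ _) (ksW hL w).continuousAt

lemma kA_add (w w' : KX L) (x : ℝ) : kA hL (w + w') x = kA hL w x + kA hL w' x := by
  simp only [kA, kW_add, mul_add]
  exact intervalIntegral.integral_add (kint _ (kcW hL w) _ _) (kint _ (kcW hL w') _ _)
lemma kB_add (w w' : KX L) (x : ℝ) : kB hL (w + w') x = kB hL w x + kB hL w' x := by
  simp only [kB, kW_add, mul_add]
  exact intervalIntegral.integral_add (kint _ (ksW hL w) _ _) (kint _ (ksW hL w') _ _)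
lemma kA_smul (c : ℝ) (w : KX L) (x : ℝ) : kA hL (c • w) x = c * kA hL w x := by
  simp only [kA, kW_smul, mul_left_comm _ c]
  exact intervalIntegral.integral_const_mul _ _
lemma kB_smul (c : ℝ) (w : KX L) (x : ℝ) : kB hL (c • w) x = c * kB hL w x := by
  simp only [kB, kW_smul, mul_left_comm _ c]
  exact intervalIntegral.integral_const_mul _ _

/-- the inverse of the spatial operator -/
noncomputable def kg (w : KX L) (x : ℝ) : ℝ := Real.sin x * kA hL w x - Real.cos x * kB hL w x
/-- its spatial derivative -/
noncomputable def kg1 (w : KX L) (x : ℝ) : ℝ := Real.cos x * kA hL w x + Real.sin x * kB hL w x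

lemma kg_der (w : KX L) (x : ℝ) : HasDerivAt (kg hL w) (kg1 hL w x) x := by
  have := ((Real.hasDerivAt_sin x).mul (kA_der hL w x)).sub
    ((Real.hasDerivAt_cos x).mul (kB_der hL w x))
  refine HasDerivAt.congr_deriv this ?_
  unfold kg1; ring

lemma kg1_der (w : KX L) (x : ℝ) : HasDerivAt (kg1 hL w) (kW hL w x - kg hL w x) x := by
  have := ((Real.hasDerivAt_cos x).mul (kA_der hL w x)).add
    ((Real.hasDerivAt_sin x).mul (kB_der hL w x))
  refine HasDerivAt.congr_deriv this ?_
  unfold kg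
  linear_combination (kW hL w x) * Real.sin_sq_add_cos_sq x

lemma kg_cont (w : KX L) : Continuous (kg hL w) :=
  continuous_iff_continuousAt.2 fun x => (kg_der hL w x).continuousAt
lemma kg1_cont (w : KX L) : Continuous (kg1 hL w) :=
  continuous_iff_continuousAt.2 fun x => (kg1_der hL w x).continuousAt

lemma kg_zero (w : KX L) : kg hL w 0 = 0 := by simp [kg, kB]
lemma kg1_zero (w : KX L) : kg1 hL w 0 = 0 := by simp [kg1, kA]
lemma kW_L (w : KX L) : kW hL w L = 0 := by simp [kW]

/-- the integral functional -/
noncomputable def kI : KX L →L[ℝ] ℝ := LinearMap.mkContinuous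
  { toFun := fun w => ∫ x in (0 : ℝ)..L, kev hL w x
    map_add' := fun w w' => by
      simp only [kev_add]
      exact intervalIntegral.integral_add (kint _ (kev_cont hL w) _ _) (kint _ (kev_cont hL w') _ _)
    map_smul' := fun c w => by
      simp only [kev_smul]
      exact intervalIntegral.integral_const_mul _ _ } L (fun w => by
    have := intervalIntegral.norm_integral_le_of_norm_le_const (a := 0) (b := L)
      (f := kev hL w) (C := ‖w‖) (fun x _ => kev_le hL w x)
    rw [sub_zero, abs_of_pos hL] at this
    simpa [mul_comm] using this)

lemma kI_apply (w : KX L) : kI hL w = ∫ x in (0 : ℝ)..L, kev hL w x := rfl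

/-- the energy -/
noncomputable def ke (w : KX L) : ℝ := kI hL (w * w)

lemma ke_apply (w : KX L) : ke hL w = ∫ x in (0 : ℝ)..L, (kev hL w x) ^ 2 := by
  simp only [ke, kI_apply, kev_mul, sq]

lemma ke_nonneg (w : KX L) : 0 ≤ ke hL w := by
  rw [ke_apply]
  exact intervalIntegral.integral_nonneg hL.le fun _ _ => sq_nonneg _

lemma ke_smul (c : ℝ) (w : KX L) : ke hL (c • w) = c ^ 2 * ke hL w := by
  simp only [ke, smul_mul_smul_comm, map_smul, smul_eq_mul, sq]

lemma ke_zero (w : KX L) (h : ke hL w ≤ 0) : w = 0 := by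
  have h0 : ∫ x in (0 : ℝ)..L, (kev hL w x) ^ 2 = 0 := by
    rw [← ke_apply]; exact le_antisymm h (ke_nonneg hL w)
  have hc : Continuous fun x => (kev hL w x) ^ 2 := (kev_cont hL w).pow 2
  ext ⟨x, hx⟩
  by_contra hne
  have := intervalIntegral.integral_pos (f := fun x => (kev hL w x) ^ 2) hL hc.continuousOn
    (fun x _ => sq_nonneg _) ⟨x, hx, by
      have : kev hL w x ≠ 0 := by rw [kev_mem hL w hx]; exact hne
      positivity⟩
  linarith

lemma kJ_sq (w : KX L) : (∫ x in (0 : ℝ)..L, |kev hL w x|) ^ 2 ≤ L * ke hL w := by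
  have := kdv_cs (y := fun x => |kev hL w x|) (kev_cont hL w).abs hL.le
  simpa [ke_apply] using this

lemma kW_le (w : KX L) {z : ℝ} (hz : z ∈ Icc 0 L) :
    |kW hL w z| ≤ ∫ x in (0 : ℝ)..L, |kev hL w x| := by
  have hc := (kev_cont hL w).abs
  calc |kW hL w z| ≤ ∫ x in z..L, |kev hL w x| :=
        intervalIntegral.abs_integral_le_integral_abs hz.2
    _ ≤ _ := intervalIntegral.integral_mono_interval hz.1 hz.2 le_rfl
        (Filter.Eventually.of_forall fun _ => abs_nonneg _) (kint _ hc _ _)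

lemma kA_le (w : KX L) {x : ℝ} (hx : x ∈ Icc 0 L) :
    |kA hL w x| ≤ (∫ x in (0 : ℝ)..L, |kev hL w x|) * L := by
  have h := intervalIntegral.norm_integral_le_of_norm_le_const (a := 0) (b := x)
      (f := fun z => Real.cos z * kW hL w z) (C := ∫ x in (0 : ℝ)..L, |kev hL w x|) (fun z hz => by
    rw [uIoc_of_le hx.1] at hz
    rw [norm_mul]
    have h1 := kW_le hL w (z := z) ⟨hz.1.le, hz.2.trans hx.2⟩
    have h2 := Real.abs_cos_le_one z
    exact (mul_le_of_le_one_left (abs_nonneg _) h2).trans h1)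
  rw [sub_zero, abs_of_nonneg hx.1] at h
  refine h.trans (mul_le_mul_of_nonneg_left hx.2 ?_)
  exact intervalIntegral.integral_nonneg hL.le fun _ _ => abs_nonneg _

lemma kB_le (w : KX L) {x : ℝ} (hx : x ∈ Icc 0 L) :
    |kB hL w x| ≤ (∫ x in (0 : ℝ)..L, |kev hL w x|) * L := by
  have h := intervalIntegral.norm_integral_le_of_norm_le_const (a := 0) (b := x)
      (f := fun z => Real.sin z * kW hL w z) (C := ∫ x in (0 : ℝ)..L, |kev hL w x|) (fun z hz => by
    rw [uIoc_of_le hx.1] at hz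
    rw [norm_mul]
    have h1 := kW_le hL w (z := z) ⟨hz.1.le, hz.2.trans hx.2⟩
    have h2 := Real.abs_sin_le_one z
    exact (mul_le_of_le_one_left (abs_nonneg _) h2).trans h1)
  rw [sub_zero, abs_of_nonneg hx.1] at h
  refine h.trans (mul_le_mul_of_nonneg_left hx.2 ?_)
  exact intervalIntegral.integral_nonneg hL.le fun _ _ => abs_nonneg _

lemma kg_le (w : KX L) {x : ℝ} (hx : x ∈ Icc 0 L) :
    |kg hL w x| ≤ 2 * L * ∫ x in (0 : ℝ)..L, |kev hL w x| := by
  have h1 := mul_le_mul (Real.abs_sin_le_one x) (kA_le hL w hx) (abs_nonneg _) zero_le_one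
  have h2 := mul_le_mul (Real.abs_cos_le_one x) (kB_le hL w hx) (abs_nonneg _) zero_le_one
  rw [← abs_mul] at h1 h2
  have := abs_sub (Real.sin x * kA hL w x) (Real.cos x * kB hL w x)
  unfold kg
  linarith

lemma kg1_le (w : KX L) {x : ℝ} (hx : x ∈ Icc 0 L) :
    |kg1 hL w x| ≤ 2 * L * ∫ x in (0 : ℝ)..L, |kev hL w x| := by
  have h1 := mul_le_mul (Real.abs_cos_le_one x) (kA_le hL w hx) (abs_nonneg _) zero_le_one
  have h2 := mul_le_mul (Real.abs_sin_le_one x) (kB_le hL w hx) (abs_nonneg _) zero_le_one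
  rw [← abs_mul] at h1 h2
  have := abs_add_le (Real.cos x * kA hL w x) (Real.sin x * kB hL w x)
  unfold kg1
  linarith

lemma kJ_le (w : KX L) : ∫ x in (0 : ℝ)..L, |kev hL w x| ≤ L * ‖w‖ := by
  have := intervalIntegral.norm_integral_le_of_norm_le_const (a := 0) (b := L)
      (f := fun x => |kev hL w x|) (C := ‖w‖) (fun x _ => by simpa using kev_le hL w x)
  rw [sub_zero, abs_of_pos hL, mul_comm] at this
  exact (le_abs_self _).trans this

/-- `G` as an operator on the state space -/
noncomputable def kG : KX L →L[ℝ] KX L := LinearMap.mkContinuous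
  { toFun := fun w => ⟨fun x => kg hL w x, (kg_cont hL w).comp continuous_subtype_val⟩
    map_add' := fun w w' => by
      ext x
      simp [kg, kA_add, kB_add]; ring
    map_smul' := fun c w => by
      ext x
      simp [kg, kA_smul, kB_smul]; ring } (2 * L * L) (fun w => by
    rw [ContinuousMap.norm_le _ (by positivity)]
    intro x
    refine (kg_le hL w x.2).trans ?_
    have := mul_le_mul_of_nonneg_left (kJ_le hL w) (show 0 ≤ 2 * L by positivity)
    linarith)

/-- `∂ₓ G` as an operator on the state space -/
noncomputable def kG1 : KX L →L[ℝ] KX L := LinearMap.mkContinuous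
  { toFun := fun w => ⟨fun x => kg1 hL w x, (kg1_cont hL w).comp continuous_subtype_val⟩
    map_add' := fun w w' => by
      ext x
      simp [kg1, kA_add, kB_add]; ring
    map_smul' := fun c w => by
      ext x
      simp [kg1, kA_smul, kB_smul]; ring } (2 * L * L) (fun w => by
    rw [ContinuousMap.norm_le _ (by positivity)]
    intro x
    refine (kg1_le hL w x.2).trans ?_
    have := mul_le_mul_of_nonneg_left (kJ_le hL w) (show 0 ≤ 2 * L by positivity)
    linarith)

lemma kG_apply (w : KX L) (x : Icc (0 : ℝ) L) : kG hL w x = kg hL w x := rfl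
lemma kG1_apply (w : KX L) (x : Icc (0 : ℝ) L) : kG1 hL w x = kg1 hL w x := rfl

lemma kev_G (w : KX L) {x : ℝ} (hx : x ∈ Icc 0 L) : kev hL (kG hL w) x = kg hL w x := by
  rw [kev_mem hL _ hx, kG_apply]
lemma kev_G1 (w : KX L) {x : ℝ} (hx : x ∈ Icc 0 L) : kev hL (kG1 hL w) x = kg1 hL w x := by
  rw [kev_mem hL _ hx, kG1_apply]

/-- evaluation at the right end point -/
noncomputable def kδ : KX L →L[ℝ] ℝ := ContinuousMap.evalCLM ℝ ⟨L, hL.le, le_rfl⟩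

/-- the observation functional -/
noncomputable def kO : KX L →L[ℝ] ℝ := (kδ hL).comp (kG1 hL)

lemma kδ_G (w : KX L) : kδ hL (kG hL w) = kg hL w L := rfl
lemma kO_apply (w : KX L) : kO hL w = kg1 hL w L := rfl

lemma ke_G (w : KX L) : ke hL (kG hL w) = ∫ x in (0 : ℝ)..L, (kg hL w x) ^ 2 := by
  rw [ke_apply]
  refine intervalIntegral.integral_congr fun x hx => ?_
  rw [uIcc_of_le hL.le] at hx
  simp only [kev_G hL w hx]

lemma ke_G1 (w : KX L) : ke hL (kG1 hL w) = ∫ x in (0 : ℝ)..L, (kg1 hL w x) ^ 2 := by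
  rw [ke_apply]
  refine intervalIntegral.integral_congr fun x hx => ?_
  rw [uIcc_of_le hL.le] at hx
  simp only [kev_G1 hL w hx]

lemma kG_norm_sq (w : KX L) : ‖kG hL w‖ ^ 2 ≤ 4 * L ^ 3 * ke hL w := by
  have h0 : 0 ≤ ∫ x in (0 : ℝ)..L, |kev hL w x| :=
    intervalIntegral.integral_nonneg hL.le fun _ _ => abs_nonneg _
  have h1 : ‖kG hL w‖ ≤ 2 * L * ∫ x in (0 : ℝ)..L, |kev hL w x| := by
    rw [ContinuousMap.norm_le _ (by positivity)]
    exact fun x => kg_le hL w x.2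
  have h2 := pow_le_pow_left₀ (norm_nonneg _) h1 2
  have h3 := kJ_sq hL w
  calc _ ≤ _ := h2
    _ = 4 * L ^ 2 * (∫ x in (0 : ℝ)..L, |kev hL w x|) ^ 2 := by ring
    _ ≤ 4 * L ^ 2 * (L * ke hL w) := mul_le_mul_of_nonneg_left h3 (by positivity)
    _ = _ := by ring

end KdvConcrete

section KdvStatic
variable {L : ℝ} (hL : 0 < L)

lemma kftc {f f' : ℝ → ℝ} (hf : ∀ x, HasDerivAt f (f' x) x) (hc : Continuous f') (a b : ℝ) :
    ∫ x in a..b, f' x = f b - f a :=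
  intervalIntegral.integral_eq_sub_of_hasDerivAt (fun x _ => hf x) (hc.intervalIntegrable _ _)

lemma kmem {L : ℝ} (hL : 0 < L) {x : ℝ} (hx : x ∈ uIcc 0 L) : x ∈ Icc 0 L := by rwa [uIcc_of_le hL.le] at hx

/-- first multiplier antiderivative -/
noncomputable def kF (w : KX L) (x : ℝ) : ℝ :=
  kg hL w x ^ 2 - 2 * kg hL w x * kW hL w x + kg1 hL w x ^ 2

lemma kF_der (w : KX L) (x : ℝ) :
    HasDerivAt (kF hL w) (2 * (kg hL w x * kev hL w x)) x := by
  have h := (((kg_der hL w x).pow 2).sub (((kg_der hL w x).const_mul 2).mul (kW_der hL w x))).add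
    ((kg1_der hL w x).pow 2)
  refine HasDerivAt.congr_deriv h ?_
  push_cast
  ring

lemma kF_zero (w : KX L) : kF hL w 0 = 0 := by simp [kF, kg_zero, kg1_zero]
lemma kF_L (w : KX L) : kF hL w L = kδ hL (kG hL w) ^ 2 + kO hL w ^ 2 := by
  simp [kF, kW_L, kδ_G, kO_apply]

lemma kS1 (w : KX L) :
    2 * kI hL (kG hL w * w) = kδ hL (kG hL w) ^ 2 + kO hL w ^ 2 := by
  have h := kftc (kF_der hL w) (continuous_const.mul ((kg_cont hL w).mul (kev_cont hL w))) 0 L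
  rw [kF_zero, kF_L, sub_zero, intervalIntegral.integral_const_mul] at h
  rw [← h, kI_apply]
  congr 1
  refine intervalIntegral.integral_congr fun x hx => ?_
  simp only [kev_mul, kev_G hL w (kmem hL hx)]

/-- the coordinate function -/
def kid (L : ℝ) : KX L := ⟨fun x => (x : ℝ), continuous_subtype_val⟩

lemma kS2 (w : KX L) :
    2 * kI hL (kid L * (kG hL w * w)) =
      L * (kδ hL (kG hL w) ^ 2 + kO hL w ^ 2) + 2 * kδ hL (kG hL w) * kO hL w
        + ke hL (kG hL w) - 3 * ke hL (kG1 hL w) := by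
  have hd : ∀ x, HasDerivAt (fun x => x * kF hL w x + 2 * (kg hL w x * kg1 hL w x))
      (2 * (x * (kg hL w x * kev hL w x)) - kg hL w x ^ 2 + 3 * kg1 hL w x ^ 2) x := by
    intro x
    have h := ((hasDerivAt_id x).mul (kF_der hL w x)).add
      (((kg_der hL w x).mul (kg1_der hL w x)).const_mul 2)
    refine HasDerivAt.congr_deriv h ?_
    simp only [id, kF]
    ring
  have c1 : Continuous fun x => 2 * (x * (kg hL w x * kev hL w x)) :=
    continuous_const.mul (continuous_id.mul ((kg_cont hL w).mul (kev_cont hL w)))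
  have c2 : Continuous fun x => kg hL w x ^ 2 := (kg_cont hL w).pow 2
  have c3 : Continuous fun x => 3 * kg1 hL w x ^ 2 := continuous_const.mul ((kg1_cont hL w).pow 2)
  have c12 : Continuous fun x => 2 * (x * (kg hL w x * kev hL w x)) - kg hL w x ^ 2 := c1.sub c2
  have h := kftc hd (c12.add c3) 0 L
  rw [intervalIntegral.integral_add (kint _ c12 _ _) (kint _ c3 _ _),
    intervalIntegral.integral_sub (kint _ c1 _ _) (kint _ c2 _ _),
    intervalIntegral.integral_const_mul, intervalIntegral.integral_const_mul,
    ← ke_G, ← ke_G1, kF_L, kg_zero] at h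
  have h2 : kI hL (kid L * (kG hL w * w)) = ∫ x in (0 : ℝ)..L, x * (kg hL w x * kev hL w x) := by
    rw [kI_apply]
    refine intervalIntegral.integral_congr fun x hx => ?_
    simp only [kev_mul, kev_G hL w (kmem hL hx), kev_mem hL (kid L) (kmem hL hx)]
    rfl
  rw [h2]
  rw [← kδ_G, ← kO_apply] at h
  linarith

lemma kyoung {ε : ℝ} (hε : 0 < ε) (a b : ℝ) : 2 * (a * b) ≤ ε * a ^ 2 + 1 / ε * b ^ 2 := by
  have h : 0 ≤ (ε * a - b) ^ 2 / ε := by positivity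
  have : (ε * a - b) ^ 2 / ε = ε * a ^ 2 + 1 / ε * b ^ 2 - 2 * (a * b) := by
    field_simp; ring
  linarith

lemma kE4 (w : KX L) {ε : ℝ} (hε : 0 < ε) {x : ℝ} (hx : x ∈ Icc 0 L) :
    kg hL w x ^ 2 ≤ ε * ke hL (kG1 hL w) + 1 / ε * ke hL (kG hL w) := by
  have hd : ∀ x, HasDerivAt (fun x => kg hL w x ^ 2) (2 * (kg1 hL w x * kg hL w x)) x := by
    intro x
    refine HasDerivAt.congr_deriv ((kg_der hL w x).pow 2) ?_
    push_cast; ring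
  have c1 : Continuous fun x => 2 * (kg1 hL w x * kg hL w x) :=
    continuous_const.mul ((kg1_cont hL w).mul (kg_cont hL w))
  have c2 : Continuous fun x => ε * kg1 hL w x ^ 2 := continuous_const.mul ((kg1_cont hL w).pow 2)
  have c3 : Continuous fun x => 1 / ε * kg hL w x ^ 2 := continuous_const.mul ((kg_cont hL w).pow 2)
  have h := kftc hd c1 0 x
  rw [kg_zero] at h
  have h1 : ∫ x in (0 : ℝ)..x, 2 * (kg1 hL w x * kg hL w x) ≤
      ∫ x in (0 : ℝ)..x, (ε * kg1 hL w x ^ 2 + 1 / ε * kg hL w x ^ 2) :=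
    intervalIntegral.integral_mono hx.1 (kint _ c1 _ _) (kint _ (c2.add c3) _ _)
      fun y => kyoung hε _ _
  have h2 : ∫ x in (0 : ℝ)..x, (ε * kg1 hL w x ^ 2 + 1 / ε * kg hL w x ^ 2) ≤
      ∫ x in (0 : ℝ)..L, (ε * kg1 hL w x ^ 2 + 1 / ε * kg hL w x ^ 2) :=
    intervalIntegral.integral_mono_interval le_rfl hx.1 hx.2
        (Filter.Eventually.of_forall fun _ => by simp only [Pi.zero_apply]; positivity)
        (kint _ (c2.add c3) _ _)
  rw [intervalIntegral.integral_add (kint _ c2 _ _) (kint _ c3 _ _) (a := 0) (b := L),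
    intervalIntegral.integral_const_mul, intervalIntegral.integral_const_mul,
    ← ke_G, ← ke_G1] at h2
  linarith

lemma kG_norm_sq' (w : KX L) : ‖kG hL w‖ ^ 2 ≤ ke hL (kG1 hL w) + ke hL (kG hL w) := by
  have h0 : 0 ≤ ke hL (kG1 hL w) + ke hL (kG hL w) := add_nonneg (ke_nonneg _ _) (ke_nonneg _ _)
  have h1 : ‖kG hL w‖ ≤ √(ke hL (kG1 hL w) + ke hL (kG hL w)) := by
    rw [ContinuousMap.norm_le _ (Real.sqrt_nonneg _)]
    intro x
    apply Real.abs_le_sqrt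
    have := kE4 hL w one_pos x.2
    rw [kG_apply]
    simpa using this
  calc _ ≤ _ := pow_le_pow_left₀ (norm_nonneg _) h1 2
    _ = _ := Real.sq_sqrt h0

lemma kg_lip (w : KX L) {x y : ℝ} (hx : x ∈ Icc 0 L) (hy : y ∈ Icc 0 L) :
    (kg hL w x - kg hL w y) ^ 2 ≤ 4 * L ^ 3 * ke hL w * (x - y) ^ 2 := by
  have h := (convex_Icc (0 : ℝ) L).norm_image_sub_le_of_norm_hasDerivWithin_le
    (fun z _ => (kg_der hL w z).hasDerivWithinAt) (fun z hz => kg1_le hL w hz) hy hx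
  have h2 := pow_le_pow_left₀ (norm_nonneg _) h 2
  have h3 := kJ_sq hL w
  simp only [Real.norm_eq_abs, mul_pow, sq_abs] at h2
  calc _ ≤ _ := h2
    _ = 4 * L ^ 2 * (x - y) ^ 2 * (∫ x in (0 : ℝ)..L, |kev hL w x|) ^ 2 := by ring
    _ ≤ 4 * L ^ 2 * (x - y) ^ 2 * (L * ke hL w) := mul_le_mul_of_nonneg_left h3 (by positivity)
    _ = _ := by ring

end KdvStatic

section KdvStatic2
variable {L : ℝ} (hL : 0 < L)

lemma kyoung_int {a b : ℝ → ℝ} (ha : Continuous a) (hb : Continuous b) {ε : ℝ} (hε : 0 < ε)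
    {x y : ℝ} (hxy : x ≤ y) :
    2 * ∫ t in x..y, a t * b t ≤ ε * (∫ t in x..y, a t ^ 2) + 1 / ε * ∫ t in x..y, b t ^ 2 := by
  have c2 : Continuous fun t => ε * a t ^ 2 := continuous_const.mul (ha.pow 2)
  have c3 : Continuous fun t => 1 / ε * b t ^ 2 := continuous_const.mul (hb.pow 2)
  have c1 : Continuous fun t => 2 * (a t * b t) := continuous_const.mul (ha.mul hb)
  rw [← intervalIntegral.integral_const_mul, ← intervalIntegral.integral_const_mul,
    ← intervalIntegral.integral_const_mul,
    ← intervalIntegral.integral_add (kint _ c2 _ _) (kint _ c3 _ _)]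
  exact intervalIntegral.integral_mono hxy (kint _ c1 _ _) (kint _ (c2.add c3) _ _)
    fun y => kyoung hε _ _

lemma kyoung_int_neg {a b : ℝ → ℝ} (ha : Continuous a) (hb : Continuous b) {ε : ℝ} (hε : 0 < ε)
    {x y : ℝ} (hxy : x ≤ y) :
    -(2 * ∫ t in x..y, a t * b t) ≤
      ε * (∫ t in x..y, a t ^ 2) + 1 / ε * ∫ t in x..y, b t ^ 2 := by
  have h := kyoung_int (a := fun t => - a t) ha.neg hb hε hxy
  simpa using h

lemma kE5 {ε : ℝ} (hε : 0 < ε) (hε1 : ε ≤ 1) : ∃ C : ℝ, 0 < C ∧ ∀ (w : KX L) (M : ℝ),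
    ‖kG hL (kG hL w)‖ ≤ M → ke hL (kG hL w) ≤ ε * ke hL (kG1 hL w) + C * M ^ 2 := by
  refine ⟨((1 + L) / (ε ^ 2 / 4) + L) / ε, by positivity, fun w M hM => ?_⟩
  set η := ε ^ 2 / 4 with hη
  have hη0 : 0 < η := by positivity
  have hM0 : 0 ≤ M := (norm_nonneg _).trans hM
  set φ := kG hL w with hφ
  have hh : ∀ x ∈ Icc 0 L, |kg hL φ x| ≤ M := fun x hx =>
    (((kG hL φ).norm_coe_le_norm ⟨x, hx⟩).trans hM)
  have cg := kg_cont hL w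
  have cg1 := kg1_cont hL w
  have cP := kW_cont hL φ
  have ch := kg_cont hL φ
  have ch1 := kg1_cont hL φ
  have cφ := kev_cont hL φ
  have hm : ke hL φ = ∫ x in (0 : ℝ)..L, kg hL w x ^ 2 := ke_G hL w
  have hn : ke hL (kG1 hL w) = ∫ x in (0 : ℝ)..L, kg1 hL w x ^ 2 := ke_G1 hL w
  -- first identity
  have i1 : ∫ x in (0 : ℝ)..L, kg1 hL w x * kW hL φ x = ke hL φ := by
    have c1 : Continuous fun x => kg1 hL w x * kW hL φ x := cg1.mul cP
    have c2 : Continuous fun x => kg hL w x * kev hL φ x := cg.mul cφ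
    have h := kftc (f := fun x => kg hL w x * kW hL φ x)
      (f' := fun x => kg1 hL w x * kW hL φ x - kg hL w x * kev hL φ x) (fun x =>
        HasDerivAt.congr_deriv ((kg_der hL w x).mul (kW_der hL φ x)) (by ring)) (c1.sub c2) 0 L
    rw [intervalIntegral.integral_sub (kint _ c1 _ _) (kint _ c2 _ _), kW_L, kg_zero] at h
    have h2 : ∫ x in (0 : ℝ)..L, kg hL w x * kev hL φ x = ke hL φ := by
      rw [hm]
      refine intervalIntegral.integral_congr fun x hx => ?_
      simp only [hφ, kev_G hL w (kmem hL hx), sq]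
    linarith
  have i2 : ∫ x in (0 : ℝ)..L, kW hL φ x ^ 2 = (∫ x in (0 : ℝ)..L, kg hL w x * kg1 hL φ x)
      + ∫ x in (0 : ℝ)..L, kW hL φ x * kg hL φ x := by
    have c1 : Continuous fun x => kW hL φ x ^ 2 := cP.pow 2
    have c2 : Continuous fun x => kev hL φ x * kg1 hL φ x := cφ.mul ch1
    have c3 : Continuous fun x => kW hL φ x * kg hL φ x := cP.mul ch
    have c23 : Continuous fun x => kev hL φ x * kg1 hL φ x + kW hL φ x * kg hL φ x := c2.add c3
    have h := kftc (f := fun x => kW hL φ x * kg1 hL φ x)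
      (f' := fun x => kW hL φ x ^ 2 - (kev hL φ x * kg1 hL φ x + kW hL φ x * kg hL φ x)) (fun x =>
        HasDerivAt.congr_deriv ((kW_der hL φ x).mul (kg1_der hL φ x)) (by ring)) (c1.sub c23) 0 L
    rw [intervalIntegral.integral_sub (kint _ c1 _ _) (kint _ c23 _ _),
      intervalIntegral.integral_add (kint _ c2 _ _) (kint _ c3 _ _), kW_L, kg1_zero] at h
    have h2 : ∫ x in (0 : ℝ)..L, kev hL φ x * kg1 hL φ x
        = ∫ x in (0 : ℝ)..L, kg hL w x * kg1 hL φ x := by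
      refine intervalIntegral.integral_congr fun x hx => ?_
      simp only [hφ, kev_G hL w (kmem hL hx)]
    linarith
  have i3 : (∫ x in (0 : ℝ)..L, kg1 hL w x * kg hL φ x)
      + (∫ x in (0 : ℝ)..L, kg hL w x * kg1 hL φ x) = kg hL w L * kg hL φ L := by
    have c1 : Continuous fun x => kg1 hL w x * kg hL φ x := cg1.mul ch
    have c2 : Continuous fun x => kg hL w x * kg1 hL φ x := cg.mul ch1
    have h := kftc (f := fun x => kg hL w x * kg hL φ x)
      (f' := fun x => kg1 hL w x * kg hL φ x + kg hL w x * kg1 hL φ x) (fun x =>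
        (kg_der hL w x).mul (kg_der hL φ x)) (c1.add c2) 0 L
    rw [intervalIntegral.integral_add (kint _ c1 _ _) (kint _ c2 _ _), kg_zero] at h
    linarith
  have i4 : ∫ x in (0 : ℝ)..L, kg hL φ x ^ 2 ≤ L * M ^ 2 := by
    have := intervalIntegral.integral_mono_on hL.le (kint _ (ch.pow 2) _ _)
      (kint _ (continuous_const (y := M ^ 2)) 0 L) (fun x hx => by
        have := pow_le_pow_left₀ (abs_nonneg _) (hh x hx) 2
        simpa using this)
    simpa using this
  have y1 := kyoung_int cg1 cP hε hL.le
  have y2 := kyoung_int cP ch one_pos hL.le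
  have y3 := kyoung_int_neg cg1 ch hη0 hL.le
  have y4 := kyoung hη0 (kg hL w L) (kg hL φ L)
  have y5 := kE4 hL w one_pos (x := L) ⟨hL.le, le_rfl⟩
  have y6 : kg hL φ L ^ 2 ≤ M ^ 2 := by
    have := pow_le_pow_left₀ (abs_nonneg _) (hh L ⟨hL.le, le_rfl⟩) 2
    simpa using this
  rw [← hn] at y1 y3
  rw [i1] at y1
  set m := ke hL φ
  set n := ke hL (kG1 hL w)
  set p := ∫ x in (0 : ℝ)..L, kW hL φ x ^ 2
  have hm0 : 0 ≤ m := ke_nonneg _ _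
  have hn0 : 0 ≤ n := ke_nonneg _ _
  have z1 : 1 / η * (∫ x in (0 : ℝ)..L, kg hL φ x ^ 2) ≤ 1 / η * (L * M ^ 2) :=
    mul_le_mul_of_nonneg_left i4 (by positivity)
  have z2 : 1 / η * kg hL φ L ^ 2 ≤ 1 / η * M ^ 2 :=
    mul_le_mul_of_nonneg_left y6 (by positivity)
  have z3 : η * kg hL w L ^ 2 ≤ η * (n + m) :=
    mul_le_mul_of_nonneg_left (by simpa [← hφ] using y5) hη0.le
  have hp : p ≤ η * (2 * n + m) + ((1 + L) / η + L) * M ^ 2 := by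
    have : ((1 + L) / η + L) * M ^ 2 = 1 / η * M ^ 2 + 1 / η * (L * M ^ 2) + L * M ^ 2 := by ring
    rw [this]
    norm_num at y2
    linarith
  have z4 : 1 / ε * p ≤ 1 / ε * (η * (2 * n + m) + ((1 + L) / η + L) * M ^ 2) :=
    mul_le_mul_of_nonneg_left hp (by positivity)
  have z5 : 1 / ε * (η * (2 * n + m) + ((1 + L) / η + L) * M ^ 2) =
      ε / 4 * (2 * n + m) + ((1 + L) / η + L) / ε * M ^ 2 := by
    have : 1 / ε * η = ε / 4 := by rw [hη]; field_simp
    calc _ = (1 / ε * η) * (2 * n + m) + ((1 + L) / η + L) / ε * M ^ 2 := by ring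
      _ = _ := by rw [this]
  have z6 : ε * m ≤ 1 * m := mul_le_mul_of_nonneg_right hε1 hm0
  have z7 : 0 ≤ ε * n := by positivity
  have z8 : 0 ≤ ((1 + L) / η + L) / ε * M ^ 2 := by positivity
  linarith

end KdvStatic2

section KdvDyn
variable {L : ℝ} (hL : 0 < L)

lemma ke_cont : Continuous (ke hL) := by
  unfold ke
  exact (kI hL).continuous.comp (continuous_id.mul continuous_id)

lemma kV_der {a b : ℝ} {u v : ℝ → KX L} (S : KdvSol (kG hL) a b u v) (q : KX L) (t : ℝ) :
    HasDerivAt (fun t => kI hL (q * (u t * u t))) (2 * kI hL (q * (u t * v t))) t := by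
  have h := ((S.der t).mul (S.der t)).const_mul q
  have h2 := (kI hL).hasFDerivAt.comp_hasDerivAt t h
  refine HasDerivAt.congr_deriv h2 ?_
  rw [mul_comm (v t) (u t), mul_add, map_add]
  ring

lemma ke_der {a b : ℝ} {u v : ℝ → KX L} (S : KdvSol (kG hL) a b u v) (t : ℝ) :
    HasDerivAt (fun t => ke hL (u t)) (2 * kI hL (u t * v t)) t := by
  have := kV_der hL S 1 t
  simp only [one_mul] at this
  exact this

lemma kV_nonneg (w : KX L) : 0 ≤ kI hL (kid L * (w * w)) := by
  rw [kI_apply]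
  refine intervalIntegral.integral_nonneg hL.le fun x hx => ?_
  rw [kev_mul, kev_mul, kev_mem hL (kid L) hx]
  exact mul_nonneg hx.1 (mul_self_nonneg _)

lemma kV_le (w : KX L) : kI hL (kid L * (w * w)) ≤ L * ke hL w := by
  rw [kI_apply, ke_apply, ← intervalIntegral.integral_const_mul]
  refine intervalIntegral.integral_mono_on hL.le (kint _ (kev_cont hL _) _ _)
    (kint _ (continuous_const.mul ((kev_cont hL _).pow 2)) _ _) fun x hx => ?_
  rw [kev_mul, kev_mul, kev_mem hL (kid L) hx, ← sq]
  exact mul_le_mul_of_nonneg_right hx.2 (sq_nonneg _)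

lemma kE1 {a b : ℝ} {u v : ℝ → KX L} (S : KdvSol (kG hL) a b u v) {s t : ℝ} (has : a ≤ s)
    (hst : s ≤ t) (htb : t ≤ b) :
    ke hL (u t) - ke hL (u s) = ∫ r in s..t, (kδ hL (u r) ^ 2 + kO hL (v r) ^ 2) := by
  have hu := S.contu
  have hv := S.cont
  rw [← kftc (ke_der hL S) (continuous_const.mul ((kI hL).continuous.comp (hu.mul hv))) s t]
  refine intervalIntegral.integral_congr fun r hr => ?_
  rw [uIcc_of_le hst] at hr
  have hr2 := S.eq r ⟨has.trans hr.1, hr.2.trans htb⟩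
  have := kS1 hL (v r)
  rw [← hr2] at this
  exact this

lemma kH2 (a b : ℝ) (u v : ℝ → KX L) (S : KdvSol (kG hL) a b u v) (t : ℝ) (ht : t ∈ Icc a b) :
    ke hL (u t) ≤ ke hL (u b) := by
  have h := kE1 hL S ht.1 ht.2 le_rfl
  have : 0 ≤ ∫ r in t..b, (kδ hL (u r) ^ 2 + kO hL (v r) ^ 2) :=
    intervalIntegral.integral_nonneg ht.2 fun _ _ => by positivity
  linarith

lemma kcf {u : ℝ → KX L} (hu : Continuous u) : Continuous fun t => kδ hL (u t) ^ 2 :=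
  ((kδ hL).continuous.comp hu).pow 2
lemma kco {u : ℝ → KX L} (hu : Continuous u) : Continuous fun t => kO hL (u t) ^ 2 :=
  ((kO hL).continuous.comp hu).pow 2
lemma kce {u : ℝ → KX L} (hu : Continuous u) : Continuous fun t => ke hL (u t) :=
  (ke_cont hL).comp hu
lemma kcn {u : ℝ → KX L} (hu : Continuous u) : Continuous fun t => ke hL (kG1 hL (u t)) :=
  (ke_cont hL).comp ((kG1 hL).continuous.comp hu)

lemma kintE {a b : ℝ} (hab : a ≤ b) {u v : ℝ → KX L} (S : KdvSol (kG hL) a b u v) :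
    ∫ t in a..b, ke hL (u t) ≤ (b - a) * ke hL (u b) := by
  have := intervalIntegral.integral_mono_on hab (kint _ (kce hL S.contu) a b)
    (kint _ (continuous_const (y := ke hL (u b))) a b) (fun t ht => kH2 hL a b u v S t ht)
  simpa using this

lemma kE2 {a b : ℝ} (hab : a ≤ b) {u v : ℝ → KX L} (S : KdvSol (kG hL) a b u v) :
    3 * ∫ t in a..b, ke hL (kG1 hL (v t)) ≤ ((b - a) + L + 1) * ke hL (u b) := by
  have hu := S.contu
  have hv := S.cont
  have h := kftc (kV_der hL S (kid L)) (continuous_const.mul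
    ((kI hL).continuous.comp (continuous_const.mul (hu.mul hv)))) a b
  have c1 : Continuous fun t => (L + 1) * (kδ hL (u t) ^ 2 + kO hL (v t) ^ 2) :=
    continuous_const.mul ((kcf hL hu).add (kco hL hv))
  have c2 := kce hL hu
  have c3 : Continuous fun t => 3 * ke hL (kG1 hL (v t)) := continuous_const.mul (kcn hL hv)
  have c12 : Continuous fun t =>
    (L + 1) * (kδ hL (u t) ^ 2 + kO hL (v t) ^ 2) + ke hL (u t) := c1.add c2
  have h2 : ∫ t in a..b, 2 * kI hL (kid L * (u t * v t)) ≤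
      ∫ t in a..b, ((L + 1) * (kδ hL (u t) ^ 2 + kO hL (v t) ^ 2) + ke hL (u t)
        - 3 * ke hL (kG1 hL (v t))) := by
    refine intervalIntegral.integral_mono_on hab (kint _ (continuous_const.mul
      ((kI hL).continuous.comp (continuous_const.mul (hu.mul hv)))) _ _)
      (kint _ (c12.sub c3) _ _) fun t ht => ?_
    rw [S.eq t ht, kS2]
    nlinarith [sq_nonneg (kδ hL (kG hL (v t)) - kO hL (v t))]
  rw [intervalIntegral.integral_sub (kint _ c12 _ _) (kint _ c3 _ _),
    intervalIntegral.integral_add (kint _ c1 _ _) (kint _ c2 _ _),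
    intervalIntegral.integral_const_mul (L + 1), intervalIntegral.integral_const_mul 3,
    ← kE1 hL S le_rfl hab le_rfl, h] at h2
  have h3 := kintE hL hab S
  have h4 := kV_nonneg hL (u b)
  have h5 := kV_le hL (u a)
  have h6 := ke_nonneg hL (u a)
  linarith

lemma kE3 {a b : ℝ} (hab : a ≤ b) {u v : ℝ → KX L} (S : KdvSol (kG hL) a b u v) :
    (b - a) * ke hL (u b) ≤ (∫ t in a..b, ke hL (u t)) +
      (b - a) * ((∫ t in a..b, kδ hL (u t) ^ 2) + ∫ t in a..b, kO hL (v t) ^ 2) := by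
  have hu := S.contu
  have hv := S.cont
  have c1 := kcf hL hu
  have c2 := kco hL hv
  rw [← intervalIntegral.integral_add (kint _ c1 _ _) (kint _ c2 _ _)]
  set A := ∫ t in a..b, (kδ hL (u t) ^ 2 + kO hL (v t) ^ 2) with hA
  have h := intervalIntegral.integral_mono_on hab (kint _ (continuous_const (y := ke hL (u b))) a b)
    (kint (fun t => ke hL (u t) + A) ((kce hL hu).add continuous_const) a b) (fun t ht => by
      have h1 := kE1 hL S ht.1 ht.2 le_rfl
      have h2 : ∫ r in t..b, (kδ hL (u r) ^ 2 + kO hL (v r) ^ 2) ≤ A :=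
        intervalIntegral.integral_mono_interval ht.1 ht.2 le_rfl
          (Filter.Eventually.of_forall fun _ => by simp only [Pi.zero_apply]; positivity)
          (kint _ (c1.add c2) _ _)
      have : ke hL (u b) ≤ ke hL (u t) + A := by linarith
      exact this)
  rw [intervalIntegral.integral_add (kint _ (kce hL hu) _ _) (kint _ continuous_const _ _)] at h
  simpa using h

lemma kDyn {a b : ℝ} (hab : a < b) : ∃ K : ℝ, 0 < K ∧ ∀ u v, KdvSol (kG hL) a b u v →
    ∀ M : ℝ, (∀ t ∈ Icc a b, ‖kG hL (u t)‖ ≤ M) →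
      ke hL (u b) ≤ K * M ^ 2 + 2 * ∫ t in a..b, kO hL (v t) ^ 2 := by
  have hT : 0 < b - a := sub_pos.2 hab
  set T := b - a with hTdef
  set K1 := T + L + 1 with hK1
  have hK10 : 0 < K1 := by positivity
  set ε := 3 / (4 * K1) with hε
  have hε0 : 0 < ε := by positivity
  set q := 1 + T / ε with hq
  have hq0 : 0 < q := by positivity
  set ε' := min 1 (3 * T / (4 * K1 * q)) with hε'
  have hε'0 : 0 < ε' := lt_min one_pos (by positivity)
  obtain ⟨C, hC, hE5⟩ := kE5 hL hε'0 (min_le_left _ _)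
  refine ⟨2 * q * C, by positivity, fun u v S M hM => ?_⟩
  have hu := S.contu
  have hv := S.cont
  have e2 := kE2 hL hab.le S
  have e3 := kE3 hL hab.le S
  have e4 : ∫ t in a..b, kδ hL (u t) ^ 2 ≤
      ε * (∫ t in a..b, ke hL (kG1 hL (v t))) + 1 / ε * ∫ t in a..b, ke hL (u t) := by
    have c2 : Continuous fun t => ε * ke hL (kG1 hL (v t)) := continuous_const.mul (kcn hL hv)
    have c3 : Continuous fun t => 1 / ε * ke hL (u t) := continuous_const.mul (kce hL hu)
    rw [← intervalIntegral.integral_const_mul, ← intervalIntegral.integral_const_mul,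
      ← intervalIntegral.integral_add (kint _ c2 _ _) (kint _ c3 _ _)]
    refine intervalIntegral.integral_mono_on hab.le (kint _ (kcf hL hu) _ _)
      (kint _ (c2.add c3) _ _) fun t ht => ?_
    have := kE4 hL (v t) hε0 (x := L) ⟨hL.le, le_rfl⟩
    rw [S.eq t ht]
    exact this
  have e5 : ∫ t in a..b, ke hL (u t) ≤
      ε' * (∫ t in a..b, ke hL (kG1 hL (v t))) + T * (C * M ^ 2) := by
    have c2 : Continuous fun t => ε' * ke hL (kG1 hL (v t)) := continuous_const.mul (kcn hL hv)
    have h := intervalIntegral.integral_mono_on hab.le (kint _ (kce hL hu) _ _)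
      (kint (fun t => ε' * ke hL (kG1 hL (v t)) + C * M ^ 2) (c2.add continuous_const) a b) (fun t ht => by
        have h1 := hM t ht
        rw [S.eq t ht] at h1
        have := hE5 (v t) M h1
        rw [← S.eq t ht] at this
        exact this)
    rw [intervalIntegral.integral_add (kint _ c2 _ _) (kint _ continuous_const _ _),
      intervalIntegral.integral_const_mul] at h
    rw [intervalIntegral.integral_const, smul_eq_mul] at h
    exact h
  set N := ∫ t in a..b, ke hL (kG1 hL (v t))
  set E := ∫ t in a..b, ke hL (u t)
  set Fi := ∫ t in a..b, kδ hL (u t) ^ 2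
  set Oi := ∫ t in a..b, kO hL (v t) ^ 2
  set eb := ke hL (u b)
  have heb : 0 ≤ eb := ke_nonneg _ _
  have hN0 : 0 ≤ N := intervalIntegral.integral_nonneg hab.le fun _ _ => ke_nonneg _ _
  have p1 : T * (ε * N) ≤ T * eb / 4 := by
    have : T * (ε * N) ≤ T * ε * (K1 * eb / 3) := by
      rw [← mul_assoc]
      exact mul_le_mul_of_nonneg_left (by linarith) (by positivity)
    have h2 : T * ε * (K1 * eb / 3) = T * eb / 4 := by rw [hε]; field_simp
    linarith
  have p2 : q * (ε' * N) ≤ T * eb / 4 := by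
    have h0 : q * (ε' * N) ≤ q * (3 * T / (4 * K1 * q) * N) :=
      mul_le_mul_of_nonneg_left (mul_le_mul_of_nonneg_right (min_le_right _ _) hN0) hq0.le
    have : q * (3 * T / (4 * K1 * q) * N) ≤ q * (3 * T / (4 * K1 * q)) * (K1 * eb / 3) := by
      rw [← mul_assoc]
      exact mul_le_mul_of_nonneg_left (by linarith) (by positivity)
    have h2 : q * (3 * T / (4 * K1 * q)) * (K1 * eb / 3) = T * eb / 4 := by field_simp
    linarith
  have p3 : T * Fi ≤ T * (ε * N) + T * (1 / ε * E) := by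
    rw [← mul_add]; exact mul_le_mul_of_nonneg_left e4 hT.le
  have p4 : q * E = E + T * (1 / ε * E) := by rw [hq]; ring
  have p5 : q * E ≤ q * (ε' * N) + q * (T * (C * M ^ 2)) := by
    rw [← mul_add]; exact mul_le_mul_of_nonneg_left e5 hq0.le
  have p6 : T * eb ≤ T * (2 * q * C * M ^ 2 + 2 * Oi) := by
    have : T * (2 * q * C * M ^ 2 + 2 * Oi) = 2 * (q * (T * (C * M ^ 2))) + 2 * (T * Oi) := by ring
    rw [this]
    linarith
  exact le_of_mul_le_mul_left p6 hT

end KdvDyn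

section KdvGrid
variable {L : ℝ} (hL : 0 < L)

lemma kE6 {a b : ℝ} (hab : a ≤ b) {u v : ℝ → KX L} (S : KdvSol (kG hL) a b u v)
    {s t : ℝ} (has : a ≤ s) (hst : s ≤ t) (htb : t ≤ b) :
    ‖kG hL (u t) - kG hL (u s)‖ ^ 2 ≤ (t - s) * ((2 * (b - a) + L + 1) * ke hL (u b)) := by
  have hu := S.contu
  have hv := S.cont
  have hG : Continuous fun r => kG hL (v r) := (kG hL).continuous.comp hv
  have h1 : ∫ r in s..t, kG hL (v r) = kG hL (u t) - kG hL (u s) :=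
    intervalIntegral.integral_eq_sub_of_hasDerivAt
      (fun r _ => (kG hL).hasFDerivAt.comp_hasDerivAt r (S.der r)) (hG.intervalIntegrable _ _)
  have h2 : ‖kG hL (u t) - kG hL (u s)‖ ≤ ∫ r in s..t, ‖kG hL (v r)‖ := by
    rw [← h1]; exact intervalIntegral.norm_integral_le_integral_norm hst
  have h3 := kdv_cs (y := fun r => ‖kG hL (v r)‖) hG.norm hst
  have h4 : ∫ r in s..t, ‖kG hL (v r)‖ ^ 2 ≤ ∫ r in a..b, ‖kG hL (v r)‖ ^ 2 :=
    intervalIntegral.integral_mono_interval has hst htb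
      (Filter.Eventually.of_forall fun _ => by simp only [Pi.zero_apply]; positivity)
      (kint _ (hG.norm.pow 2) _ _)
  have h5 : ∫ r in a..b, ‖kG hL (v r)‖ ^ 2 ≤
      ∫ r in a..b, (ke hL (kG1 hL (v r)) + ke hL (u r)) := by
    refine intervalIntegral.integral_mono_on hab (kint _ (hG.norm.pow 2) _ _)
      (kint _ ((kcn hL hv).add (kce hL hu)) _ _) fun r hr => ?_
    rw [S.eq r hr]
    exact kG_norm_sq' hL (v r)
  rw [intervalIntegral.integral_add (kint _ (kcn hL hv) _ _) (kint _ (kce hL hu) _ _)] at h5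
  have h6 := kE2 hL hab S
  have h7 := kintE hL hab S
  have h8 : 0 ≤ ∫ t in a..b, ke hL (kG1 hL (v t)) :=
    intervalIntegral.integral_nonneg hab fun _ _ => ke_nonneg _ _
  calc _ ≤ (∫ r in s..t, ‖kG hL (v r)‖) ^ 2 := pow_le_pow_left₀ (norm_nonneg _) h2 2
    _ ≤ _ := h3
    _ ≤ _ := mul_le_mul_of_nonneg_left (by linarith) (sub_nonneg.2 hst)

lemma kE6' {a b : ℝ} (hab : a ≤ b) {u v : ℝ → KX L} (S : KdvSol (kG hL) a b u v)
    {s t : ℝ} (hs : s ∈ Icc a b) (ht : t ∈ Icc a b) :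
    ‖kG hL (u t) - kG hL (u s)‖ ^ 2 ≤ |t - s| * ((2 * (b - a) + L + 1) * ke hL (u b)) := by
  rcases le_total s t with h | h
  · rw [abs_of_nonneg (sub_nonneg.2 h)]
    exact kE6 hL hab S hs.1 h ht.2
  · rw [abs_sub_comm, abs_of_nonneg (sub_nonneg.2 h), norm_sub_rev]
    exact kE6 hL hab S ht.1 h hs.2

lemma kH1 (a b : ℝ) (hab : a < b) : ∃ (n : ℕ) (m : Fin n → (KX L →L[ℝ] ℝ)) (τ : Fin n → ℝ)
    (C : ℝ), 0 < C ∧ (∀ j, τ j ∈ Icc a b) ∧ ∀ u v, KdvSol (kG hL) a b u v →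
      ke hL (u b) ≤ C * ((∑ j, (m j (kG hL (u (τ j)))) ^ 2) + ∫ t in a..b, (kO hL (v t)) ^ 2) := by
  obtain ⟨K, hK, hdyn⟩ := kDyn hL hab
  have hT : 0 < b - a := sub_pos.2 hab
  set K2 := 2 * (b - a) + L + 1 with hK2
  have hK20 : 0 < K2 := by positivity
  set K4 := 4 * L ^ 3 + K2 with hK4
  have hK40 : 0 < K4 := by positivity
  set δ := min 1 (1 / (6 * K * K4)) with hδ
  have hδ0 : 0 < δ := lt_min one_pos (by positivity)
  have hδ1 : δ ≤ 1 := min_le_left _ _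
  obtain ⟨N, hN, hNf, hcov⟩ :=
    ((isCompact_Icc (a := (0 : ℝ)) (b := L)).prod (isCompact_Icc (a := a) (b := b))).finite_cover_balls
      hδ0
  classical
  have := hNf.fintype
  let eq := (Fintype.equivFin N).symm
  refine ⟨Fintype.card N, fun j => ContinuousMap.evalCLM ℝ ⟨(eq j).1.1, (hN (eq j).2).1⟩,
    fun j => (eq j).1.2, 6 * K + 4, by positivity, fun j => (hN (eq j).2).2, fun u v S => ?_⟩
  simp only []
  set Sg := ∑ j, ((ContinuousMap.evalCLM ℝ (⟨(eq j).1.1, (hN (eq j).2).1⟩ : Icc (0 : ℝ) L))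
    (kG hL (u (eq j).1.2))) ^ 2 with hSg
  have hSg0 : 0 ≤ Sg := Finset.sum_nonneg fun _ _ => sq_nonneg _
  set eb := ke hL (u b)
  have heb : 0 ≤ eb := ke_nonneg _ _
  have hO : 0 ≤ ∫ t in a..b, kO hL (v t) ^ 2 :=
    intervalIntegral.integral_nonneg hab.le fun _ _ => sq_nonneg _
  have hR : 0 ≤ 3 * Sg + 3 * δ * K4 * eb := by positivity
  have key : ∀ t ∈ Icc a b, ‖kG hL (u t)‖ ≤ √(3 * Sg + 3 * δ * K4 * eb) := by
    intro t ht
    rw [ContinuousMap.norm_le _ (Real.sqrt_nonneg _)]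
    intro x
    apply Real.abs_le_sqrt
    have hxt : ((x : ℝ), t) ∈ Icc (0 : ℝ) L ×ˢ Icc a b := ⟨x.2, ht⟩
    obtain ⟨p, hp, hpd⟩ := mem_iUnion₂.1 (hcov hxt)
    rw [Metric.mem_ball, Prod.dist_eq, max_lt_iff, Real.dist_eq, Real.dist_eq] at hpd
    have hp1 : p.1 ∈ Icc 0 L := (hN hp).1
    have hp2 : p.2 ∈ Icc a b := (hN hp).2
    have a1 : (kg hL (u t) x - kg hL (u t) p.1) ^ 2 ≤ 4 * L ^ 3 * eb * δ := by
      have h1 := kg_lip hL (u t) x.2 hp1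
      have h2 := kH2 hL a b u v S t ht
      have h3 : ((x : ℝ) - p.1) ^ 2 ≤ δ := by
        have h4 := hpd.1
        simp only at h4
        have h5 : |(x : ℝ) - p.1| ^ 2 ≤ δ ^ 2 := pow_le_pow_left₀ (abs_nonneg _) h4.le 2
        rw [sq_abs] at h5
        nlinarith
      calc _ ≤ _ := h1
        _ ≤ _ := by
          have := ke_nonneg hL (u t)
          gcongr
    have a2 : (kg hL (u t) p.1 - kg hL (u p.2) p.1) ^ 2 ≤ δ * (K2 * eb) := by
      have h1 := kE6' hL hab.le S hp2 ht
      have h2 := (kG hL (u t) - kG hL (u p.2)).norm_coe_le_norm ⟨p.1, hp1⟩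
      have h3 := pow_le_pow_left₀ (norm_nonneg _) h2 2
      rw [Real.norm_eq_abs, sq_abs] at h3
      calc _ ≤ _ := h3
        _ ≤ _ := h1
        _ ≤ _ := mul_le_mul_of_nonneg_right hpd.2.le (by positivity)
    have a3 : (kg hL (u p.2) p.1) ^ 2 ≤ Sg := by
      have h1 := Finset.single_le_sum (f := fun j => ((ContinuousMap.evalCLM ℝ
        (⟨(eq j).1.1, (hN (eq j).2).1⟩ : Icc (0 : ℝ) L)) (kG hL (u (eq j).1.2))) ^ 2)
        (fun _ _ => sq_nonneg _) (Finset.mem_univ (eq.symm ⟨p, hp⟩))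
      refine le_trans (le_of_eq ?_) h1
      have h2 : eq (eq.symm ⟨p, hp⟩) = ⟨p, hp⟩ := eq.apply_symm_apply _
      simp only [ContinuousMap.evalCLM_apply, kG_apply, h2]
    rw [kG_apply]
    set A := kg hL (u t) x
    set B := kg hL (u t) p.1
    set D := kg hL (u p.2) p.1
    have a4 : A ^ 2 ≤ 3 * ((A - B) ^ 2 + (B - D) ^ 2 + D ^ 2) := by
      nlinarith [sq_nonneg (A - B - (B - D)), sq_nonneg (A - B - D), sq_nonneg (B - D - D)]
    have a5 : 3 * δ * K4 * eb = 3 * (4 * L ^ 3 * eb * δ) + 3 * (δ * (K2 * eb)) := by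
      rw [hK4]; ring
    linarith
  have h := hdyn u v S _ key
  rw [Real.sq_sqrt hR] at h
  have h2 : K * (3 * δ * K4 * eb) ≤ eb / 2 := by
    have h3 : δ * (3 * K * K4 * eb) ≤ 1 / (6 * K * K4) * (3 * K * K4 * eb) :=
      mul_le_mul_of_nonneg_right (min_le_right _ _) (by positivity)
    have h4 : 1 / (6 * K * K4) * (3 * K * K4 * eb) = eb / 2 := by field_simp; ring
    calc _ = δ * (3 * K * K4 * eb) := by ring
      _ ≤ _ := h3
      _ = _ := h4
  have h5 : 0 ≤ K * ∫ t in a..b, kO hL (v t) ^ 2 := by positivity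
  linarith

end KdvGrid

section KdvSpectral

lemma kconst {L : ℝ} {h : ℝ → ℂ} (hd : ∀ x ∈ Icc 0 L, HasDerivAt h 0 x) {x : ℝ}
    (hx : x ∈ Icc 0 L) : h x = h 0 := by
  have := (convex_Icc (0 : ℝ) L).norm_image_sub_le_of_norm_hasDerivWithin_le (C := 0)
    (fun z hz => (hd z hz).hasDerivWithinAt) (fun z _ => by simp)
    (⟨le_rfl, hx.1.trans hx.2⟩ : (0 : ℝ) ∈ Icc 0 L) hx
  rw [zero_mul] at this
  exact sub_eq_zero.1 (norm_le_zero_iff.1 this)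

lemma kexp {L : ℝ} {Q : ℝ → ℂ} {r : ℂ} (hd : ∀ x ∈ Icc 0 L, HasDerivAt Q (r * Q x) x) {x : ℝ}
    (hx : x ∈ Icc 0 L) : Q x = Complex.exp (r * x) * Q 0 := by
  have h1 : ∀ y ∈ Icc 0 L, HasDerivAt (fun y : ℝ => Complex.exp (-(r * y)) * Q y) 0 y := by
    intro y hy
    have he : HasDerivAt (fun y : ℝ => Complex.exp (-(r * y))) (Complex.exp (-(r * y)) * (-r)) y := by
      have h0 : HasDerivAt (fun y : ℝ => -(r * (y : ℂ))) (-r) y := by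
        have := ((Complex.ofRealCLM.hasDerivAt (x := y)).const_mul r).neg
        refine HasDerivAt.congr_deriv this ?_
        simp
      exact h0.cexp
    refine HasDerivAt.congr_deriv (he.mul (hd y hy)) ?_
    ring
  have h2 := kconst h1 hx
  simp only [Complex.ofReal_zero, mul_zero, neg_zero, Complex.exp_zero, one_mul] at h2
  rw [← h2, ← mul_assoc, ← Complex.exp_add]
  simp

lemma kroots (l : ℂ) : ∃ μ ν : ℂ, μ ^ 3 + μ + l = 0 ∧ ν ^ 2 + μ * ν + μ ^ 2 + 1 = 0 := by
  obtain ⟨μ, hμ⟩ := IsAlgClosed.exists_root (Polynomial.X ^ 3 + Polynomial.X + Polynomial.C l)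
    (by
      have : (Polynomial.X ^ 3 + Polynomial.X + Polynomial.C l : Polynomial ℂ).degree = 3 := by
        compute_degree!
      rw [this]; norm_num)
  obtain ⟨s, hs⟩ := IsAlgClosed.exists_pow_nat_eq (μ ^ 2 - 4 * (μ ^ 2 + 1)) (n := 2) (by norm_num)
  refine ⟨μ, (-μ + s) / 2, by simpa using hμ, ?_⟩
  linear_combination (1 / 4 : ℂ) * hs

lemma keigen {L : ℝ} (hL : 0 < L) (hLF : L ∉ kdvCriticalSetF) {f f1 f2 : ℝ → ℂ} {l : ℂ}
    (d0 : ∀ x ∈ Icc 0 L, HasDerivAt f (f1 x) x)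
    (d1 : ∀ x ∈ Icc 0 L, HasDerivAt f1 (f2 x) x)
    (d2 : ∀ x ∈ Icc 0 L, HasDerivAt f2 (-(f1 x) - l * f x) x)
    (z0 : f 0 = 0) (z1 : f1 0 = 0) (zL : f1 L = 0) (zb : f2 L + f L = 0) :
    ∀ x ∈ Icc 0 L, f x = 0 := by
  obtain ⟨μ, ν, hμ, hν⟩ := kroots l
  have hLm : L ∈ Icc 0 L := ⟨hL.le, le_rfl⟩
  have hQ : ∀ r : ℂ, r ^ 3 + r + l = 0 → ∀ x ∈ Icc 0 L,
      f2 x + r * f1 x + (r ^ 2 + 1) * f x = Complex.exp (r * x) * f2 0 := by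
    intro r hr x hx
    have := kexp (Q := fun x => f2 x + r * f1 x + (r ^ 2 + 1) * f x) (r := r) (L := L)
      (fun y hy => by
        refine HasDerivAt.congr_deriv (((d2 y hy).add ((d1 y hy).const_mul r)).add
          ((d0 y hy).const_mul (r ^ 2 + 1))) ?_
        linear_combination (-f y) * hr) hx
    simpa [z0, z1] using this
  have hQL : ∀ r : ℂ, r ^ 3 + r + l = 0 → r ^ 2 * f L = Complex.exp (r * L) * f2 0 := by
    intro r hr
    rw [← hQ r hr L hLm, zL]
    linear_combination (-1 : ℂ) * zb
  have hν3 : ν ^ 3 + ν + l = 0 := by linear_combination (ν - μ) * hν + hμ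
  set κ := -μ - ν with hκ
  have hκ3 : κ ^ 3 + κ + l = 0 := by rw [hκ]; linear_combination hμ - (2 * μ + ν) * hν
  by_cases h : f2 0 = 0
  · have q0 : ∀ x ∈ Icc 0 L, f2 x + μ * f1 x + (μ ^ 2 + 1) * f x = 0 := fun x hx => by
      rw [hQ μ hμ x hx, h, mul_zero]
    have r0 : ∀ x ∈ Icc 0 L, f1 x - κ * f x = 0 := fun x hx => by
      have := kexp (Q := fun x => f1 x - κ * f x) (r := ν) (L := L) (fun y hy => by
        refine HasDerivAt.congr_deriv ((d1 y hy).sub ((d0 y hy).const_mul κ)) ?_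
        rw [hκ]
        linear_combination q0 y hy - f y * hν) hx
      simpa [z0, z1] using this
    intro x hx
    have := kexp (Q := f) (r := κ) (L := L) (fun y hy =>
      HasDerivAt.congr_deriv (d0 y hy) (sub_eq_zero.1 (r0 y hy))) hx
    simpa [z0] using this
  · exfalso
    have hne : ∀ r : ℂ, r ^ 3 + r + l = 0 → r ≠ 0 := by
      rintro r hr rfl
      have := hQL 0 hr
      simp at this
      exact h this.symm
    have hv : ∀ r : ℂ, r ^ 3 + r + l = 0 →
        Complex.exp (L * r) / (L * r) ^ 2 = f L / (L ^ 2 * f2 0) := by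
      intro r hr
      have hr0 := hne r hr
      have hLc : (L : ℂ) ≠ 0 := by exact_mod_cast hL.ne'
      have := hQL r hr
      rw [mul_comm r] at this
      rw [div_eq_div_iff (by positivity) (by positivity)]
      linear_combination (-(L : ℂ) ^ 2) * this
    have hLc : (L : ℂ) ≠ 0 := by exact_mod_cast hL.ne'
    have hs : (L : ℂ) * μ + L * ν = -(L * κ) := by rw [hκ]; ring
    refine hLF ⟨hL, L * μ, L * ν, mul_ne_zero hLc (hne μ hμ), mul_ne_zero hLc (hne ν hν3), ?_, ?_,
      ?_, ?_⟩
    · rw [hs]; exact neg_ne_zero.2 (mul_ne_zero hLc (hne κ hκ3))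
    · linear_combination ((L : ℂ) ^ 2) * hν
    · rw [hv μ hμ, hv ν hν3]
    · rw [hs, neg_neg, neg_sq, hv ν hν3, hv κ hκ3]

/-- chains of functions -/
structure KdvSeq (L : ℝ) (f f1 f2 : ℕ → ℝ → ℂ) : Prop where
  d0 : ∀ k, ∀ x ∈ Icc 0 L, HasDerivAt (f k) (f1 k x) x
  d1 : ∀ k, ∀ x ∈ Icc 0 L, HasDerivAt (f1 k) (f2 k x) x
  d2 : ∀ k, ∀ x ∈ Icc 0 L, HasDerivAt (f2 k) (-(f1 k x) - f (k + 1) x) x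
  z0 : ∀ k, f k 0 = 0
  z1 : ∀ k, f1 k 0 = 0
  zL : ∀ k, f1 k L = 0
  zb : ∀ k, f2 k L + f k L = 0

/-- the shift -/
def kshift : Module.End ℂ (ℕ → ℝ → ℂ) where
  toFun f k := f (k + 1)
  map_add' _ _ := rfl
  map_smul' _ _ := rfl

lemma kshift_pow (j : ℕ) (f : ℕ → ℝ → ℂ) (k : ℕ) : (kshift ^ j) f k = f (k + j) := by
  induction j generalizing f k with
  | zero => rfl
  | succ j ih =>
    rw [pow_succ, Module.End.mul_apply, ih]
    change f (k + j + 1) = _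
    rw [add_assoc]

lemma KdvSeq.op {L : ℝ} {f f1 f2 : ℕ → ℝ → ℂ} (S : KdvSeq L f f1 f2) (l : ℂ) :
    KdvSeq L (fun k x => f (k + 1) x - l * f k x) (fun k x => f1 (k + 1) x - l * f1 k x)
      (fun k x => f2 (k + 1) x - l * f2 k x) where
  d0 k x hx := (S.d0 (k + 1) x hx).sub ((S.d0 k x hx).const_mul l)
  d1 k x hx := (S.d1 (k + 1) x hx).sub ((S.d1 k x hx).const_mul l)
  d2 k x hx := HasDerivAt.congr_deriv ((S.d2 (k + 1) x hx).sub ((S.d2 k x hx).const_mul l))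
    (by ring)
  z0 k := by simp [S.z0]
  z1 k := by simp [S.z1]
  zL k := by simp [S.zL]
  zb k := by linear_combination S.zb (k + 1) - l * S.zb k

lemma kchain {L : ℝ} (hL : 0 < L) (hLF : L ∉ kdvCriticalSetF) (s : Multiset ℂ) :
    ∀ f f1 f2 : ℕ → ℝ → ℂ, KdvSeq L f f1 f2 →
      (∀ x ∈ Icc 0 L, (Polynomial.aeval kshift
        (s.map fun a => Polynomial.X - Polynomial.C a).prod) f 0 x = 0) →
      ∀ x ∈ Icc 0 L, f 0 x = 0 := by
  induction s using Multiset.induction with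
  | empty =>
    intro f f1 f2 _ h x hx
    simpa using h x hx
  | cons l s ih =>
    intro f f1 f2 S h
    have h1 := ih _ _ _ (S.op l) (fun x hx => by
      have h2 := h x hx
      rw [Multiset.map_cons, Multiset.prod_cons, mul_comm, map_mul, Module.End.mul_apply] at h2
      have h3 : (Polynomial.aeval kshift (Polynomial.X - Polynomial.C l)) f =
          fun k x => f (k + 1) x - l * f k x := by
        ext k x
        simp [kshift, Algebra.algebraMap_eq_smul_one]
      rw [h3] at h2
      exact h2)
    simp only [zero_add] at h1
    refine keigen hL hLF (l := l) (S.d0 0) (S.d1 0) (fun x hx => ?_) (S.z0 0) (S.z1 0) (S.zL 0)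
      (S.zb 0)
    refine HasDerivAt.congr_deriv (S.d2 0 x hx) ?_
    linear_combination (-1 : ℂ) * h1 x hx

lemma kchain_poly {L : ℝ} (hL : 0 < L) (hLF : L ∉ kdvCriticalSetF) (P : Polynomial ℂ) (hP : P ≠ 0)
    (f f1 f2 : ℕ → ℝ → ℂ) (S : KdvSeq L f f1 f2)
    (h : ∀ x ∈ Icc 0 L, (P.sum fun k c => c * f k x) = 0) : ∀ x ∈ Icc 0 L, f 0 x = 0 := by
  refine kchain hL hLF P.roots f f1 f2 S fun x hx => ?_
  have h1 := h x hx
  have h2 : (Polynomial.aeval kshift P) f 0 x = 0 := by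
    rw [← h1, Polynomial.aeval_def, Polynomial.eval₂_eq_sum, Polynomial.sum, Polynomial.sum]
    simp [kshift_pow]
  have h3 := (IsAlgClosed.splits P).eq_prod_roots
  rw [h3, map_mul, Polynomial.aeval_C, Module.End.mul_apply] at h2
  have hl : P.leadingCoeff ≠ 0 := by simpa using hP
  simpa [Algebra.algebraMap_eq_smul_one, hl] using h2

end KdvSpectral

section KdvH4
variable {L : ℝ} (hL : 0 < L)

lemma kH4 (hLF : L ∉ kdvCriticalSetF) (φ : ℕ → KX L) (P : Polynomial ℝ)
    (hφ : ∀ k, φ k = kG hL (φ (k + 1))) (hO : ∀ k, kO hL (φ k) = 0) (hP : P ≠ 0)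
    (hs : (P.sum fun k c => c • φ k) = 0) : φ 0 = 0 := by
  have hv : ∀ k, ∀ x ∈ Icc 0 L, kev hL (φ k) x = kg hL (φ (k + 1)) x := fun k x hx => by
    rw [hφ k, kev_G hL _ hx]
  have S : KdvSeq L (fun k x => ((kg hL (φ (k + 1)) x : ℝ) : ℂ))
      (fun k x => ((kg1 hL (φ (k + 1)) x : ℝ) : ℂ))
      (fun k x => ((kW hL (φ (k + 1)) x - kg hL (φ (k + 1)) x : ℝ) : ℂ)) :=
    { d0 := fun k x _ => (kg_der hL _ x).ofReal_comp
      d1 := fun k x _ => (kg1_der hL _ x).ofReal_comp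
      d2 := fun k x hx => by
        refine HasDerivAt.congr_deriv ((kW_der hL _ x).sub (kg_der hL _ x)).ofReal_comp ?_
        rw [hv (k + 1) x hx]
        push_cast; ring
      z0 := fun k => by simp [kg_zero]
      z1 := fun k => by simp [kg1_zero]
      zL := fun k => by simp [← kO_apply, hO]
      zb := fun k => by simp [kW_L] }
  have h := kchain_poly hL hLF (P.map (algebraMap ℝ ℂ))
    ((Polynomial.map_ne_zero_iff (algebraMap ℝ ℂ).injective).2 hP) _ _ _ S (fun x hx => by
      rw [Polynomial.sum_def, Polynomial.support_map_of_injective _ (algebraMap ℝ ℂ).injective]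
      have h1 : (P.sum fun k c => c • φ k) ⟨x, hx⟩ = 0 := by rw [hs]; rfl
      rw [Polynomial.sum_def, ContinuousMap.sum_apply] at h1
      have h2 := congrArg (fun y : ℝ => (y : ℂ)) h1
      simp only [Complex.ofReal_sum, Complex.ofReal_zero] at h2
      rw [← h2]
      refine Finset.sum_congr rfl fun k _ => ?_
      have h3 := hv k x hx
      rw [kev_mem hL _ hx] at h3
      simp [h3])
  ext ⟨x, hx⟩
  have h1 := h x hx
  have h2 := hv 0 x hx
  rw [kev_mem hL _ hx] at h2
  rw [h2]
  exact_mod_cast h1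

lemma kObs (hLF : L ∉ kdvCriticalSetF) {a b : ℝ} (hab : a < b) :
    ∃ C, 0 < C ∧ ∀ u v, KdvSol (kG hL) a b u v →
      ke hL (u b) ≤ C * ∫ t in a..b, (kO hL (v t)) ^ 2 :=
  kdv_abstract (kG hL) (kO hL) (ke hL) (kH1 hL) (kH2 hL)
    ⟨4 * L ^ 3, by positivity, kG_norm_sq hL⟩ (ke_smul hL) (kH4 hL hLF) (ke_zero hL) hab

end KdvH4

section KdvFinal
variable {L : ℝ} (hL : 0 < L)

lemma kuniq (w : KX L) {g g1 g2 : ℝ → ℝ}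
    (d0 : ∀ x ∈ Icc 0 L, HasDerivAt g (g1 x) x)
    (d1 : ∀ x ∈ Icc 0 L, HasDerivAt g1 (g2 x) x)
    (d2 : ∀ x ∈ Icc 0 L, HasDerivAt g2 (-(g1 x) - kev hL w x) x)
    (z0 : g 0 = 0) (z1 : g1 0 = 0) (zb : g L + g2 L = 0) :
    ∀ x ∈ Icc 0 L, g x = kg hL w x ∧ g1 x = kg1 hL w x := by
  have hc : ∀ x ∈ Icc 0 L, HasDerivAt (fun x => ((g x + g2 x - kW hL w x : ℝ) : ℂ)) 0 x := by
    intro x hx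
    refine HasDerivAt.congr_deriv
      (((d0 x hx).add (d2 x hx)).sub (kW_der hL w x)).ofReal_comp ?_
    push_cast; ring
  have hc0 : ∀ x ∈ Icc 0 L, g2 x = kW hL w x - g x := by
    intro x hx
    have h1 := kconst hc hx
    have h2 := kconst hc (⟨hL.le, le_rfl⟩ : L ∈ Icc 0 L)
    rw [← h2, kW_L, zb, sub_zero] at h1
    have h3 : g x + g2 x - kW hL w x = 0 := by exact_mod_cast h1
    linarith
  intro x hx
  have h := kexp (Q := fun x => ((g1 x - kg1 hL w x : ℝ) : ℂ) +
    Complex.I * ((g x - kg hL w x : ℝ) : ℂ)) (r := Complex.I) (L := L) (fun y hy => by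
      refine HasDerivAt.congr_deriv (((d1 y hy).sub (kg1_der hL w y)).ofReal_comp.add
        ((((d0 y hy).sub (kg_der hL w y)).ofReal_comp).const_mul Complex.I)) ?_
      rw [hc0 y hy]
      push_cast
      linear_combination (-(g y : ℂ) + kg hL w y) * Complex.I_mul_I) hx
  simp only [z0, z1, kg_zero, kg1_zero, sub_zero, Complex.ofReal_zero, mul_zero, add_zero] at h
  have hre := congrArg Complex.re h
  have him := congrArg Complex.im h
  simp at hre him
  constructor <;> linarith

end KdvFinal

/-- **Observability inequality for the backward adjoint linear KdV system.**
If `L ∉ 𝔽`, there is a constant `C > 0` depending only on `L` and `T` such that every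
classical solution `ψ` of the backward adjoint system satisfies
`∫₀^L ψ(x,T)² dx ≤ C ∫₀^T ψ_x(L,t)² dt`. -/
theorem backward_adjoint_kdv_observability
    (L T : ℝ) (hL : 0 < L) (hT : 0 < T) (hLF : L ∉ kdvCriticalSetF) :
    ∃ C : ℝ, 0 < C ∧
      ∀ (ψ ψt ψx ψxx ψxxx : ℝ → ℝ → ℝ),
        (∀ x ∈ Icc (0:ℝ) L, ∀ t ∈ Icc (0:ℝ) T,
          HasDerivAt (fun s => ψ x s) (ψt x t) t) →
        (∀ x ∈ Icc (0:ℝ) L, ∀ t ∈ Icc (0:ℝ) T,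
          HasDerivAt (fun y => ψ y t) (ψx x t) x) →
        (∀ x ∈ Icc (0:ℝ) L, ∀ t ∈ Icc (0:ℝ) T,
          HasDerivAt (fun y => ψx y t) (ψxx x t) x) →
        (∀ x ∈ Icc (0:ℝ) L, ∀ t ∈ Icc (0:ℝ) T,
          HasDerivAt (fun y => ψxx y t) (ψxxx x t) x) →
        ContinuousOn (fun p : ℝ × ℝ => ψ p.1 p.2) (Icc 0 L ×ˢ Icc 0 T) →
        ContinuousOn (fun p : ℝ × ℝ => ψt p.1 p.2) (Icc 0 L ×ˢ Icc 0 T) →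
        ContinuousOn (fun p : ℝ × ℝ => ψx p.1 p.2) (Icc 0 L ×ˢ Icc 0 T) →
        ContinuousOn (fun p : ℝ × ℝ => ψxx p.1 p.2) (Icc 0 L ×ˢ Icc 0 T) →
        ContinuousOn (fun p : ℝ × ℝ => ψxxx p.1 p.2) (Icc 0 L ×ˢ Icc 0 T) →
        (∀ x ∈ Icc (0:ℝ) L, ∀ t ∈ Icc (0:ℝ) T,
          ψt x t + ψx x t + ψxxx x t = 0) →
        (∀ t ∈ Icc (0:ℝ) T, ψ 0 t = 0) →
        (∀ t ∈ Icc (0:ℝ) T, ψx 0 t = 0) →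
        (∀ t ∈ Icc (0:ℝ) T, ψ L t + ψxx L t = 0) →
          (∫ x in (0:ℝ)..L, (ψ x T) ^ 2) ≤ C * ∫ t in (0:ℝ)..T, (ψx L t) ^ 2 := by
  obtain ⟨C, hC, hmain⟩ := kObs hL hLF hT
  refine ⟨C, hC, ?_⟩
  intro ψ ψt ψx ψxx ψxxx dt dx dxx dxxx cψ ct _ _ _ pde b0 b1 b2
  have cF : Continuous fun p : ℝ × Icc (0 : ℝ) L => ψt p.2 (projIcc 0 T hT.le p.1) := by
    have := ct.comp_continuous (f := fun p : ℝ × Icc (0 : ℝ) L =>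
      ((p.2 : ℝ), ((projIcc 0 T hT.le p.1 : Icc (0 : ℝ) T) : ℝ)))
      ((continuous_subtype_val.comp continuous_snd).prodMk
        (continuous_subtype_val.comp (continuous_projIcc.comp continuous_fst)))
      (fun p => ⟨p.2.2, (projIcc 0 T hT.le p.1).2⟩)
    exact this
  let v : C(ℝ, KX L) := ContinuousMap.curry ⟨_, cF⟩
  have hv : ∀ t (x : Icc (0 : ℝ) L), v t x = ψt x (projIcc 0 T hT.le t) := fun _ _ => rfl
  have h0T : (0 : ℝ) ∈ Icc 0 T := ⟨le_rfl, hT.le⟩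
  let u0 : KX L := ⟨fun x => ψ x 0, by
    have := cψ.comp_continuous (f := fun p : Icc (0 : ℝ) L => ((p : ℝ), (0 : ℝ)))
      (continuous_subtype_val.prodMk continuous_const) (fun p => ⟨p.2, h0T⟩)
    exact this⟩
  let u : ℝ → KX L := fun t => u0 + ∫ r in (0 : ℝ)..t, v r
  have hu : ∀ t ∈ Icc 0 T, ∀ x : Icc (0 : ℝ) L, u t x = ψ x t := by
    intro t ht x
    have h1 : (∫ r in (0 : ℝ)..t, v r) x = ∫ r in (0 : ℝ)..t, v r x :=
      ((ContinuousMap.evalCLM ℝ x).intervalIntegral_comp_comm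
        (v.continuous.intervalIntegrable 0 t)).symm
    have h2 : ∫ r in (0 : ℝ)..t, v r x = ψ x t - ψ x 0 := by
      refine intervalIntegral.integral_eq_sub_of_hasDerivAt (f := fun s => ψ x s) (fun r hr => ?_)
        (((ContinuousMap.evalCLM ℝ x).continuous.comp v.continuous).intervalIntegrable 0 t)
      rw [uIcc_of_le ht.1] at hr
      have hr' : r ∈ Icc 0 T := ⟨hr.1, hr.2.trans ht.2⟩
      rw [hv, projIcc_of_mem hT.le hr']
      exact dt x x.2 r hr'
    change ψ x 0 + (∫ r in (0 : ℝ)..t, v r) x = ψ x t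
    rw [h1, h2]; ring
  have hst : ∀ t ∈ Icc 0 T, ∀ x ∈ Icc 0 L, ψ x t = kg hL (v t) x ∧ ψx x t = kg1 hL (v t) x := by
    intro t ht
    refine kuniq hL (v t) (fun x hx => dx x hx t ht) (fun x hx => dxx x hx t ht) (fun x hx => ?_)
      (b0 t ht) (b1 t ht) (b2 t ht)
    refine HasDerivAt.congr_deriv (dxxx x hx t ht) ?_
    rw [kev_mem hL _ hx, hv, projIcc_of_mem hT.le ht]
    have := pde x hx t ht
    simp only
    linarith
  have S : KdvSol (kG hL) 0 T u v :=
    { cont := v.continuous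
      der := fun t => (intervalIntegral.integral_hasDerivAt_right
        (v.continuous.intervalIntegrable _ _) (v.continuous.stronglyMeasurableAtFilter _ _)
        v.continuous.continuousAt).const_add u0
      eq := fun t ht => by
        ext x
        rw [hu t ht, kG_apply, (hst t ht x x.2).1] }
  have h := hmain u v S
  have hTm : T ∈ Icc 0 T := ⟨hT.le, le_rfl⟩
  have e1 : ke hL (u T) = ∫ x in (0:ℝ)..L, (ψ x T) ^ 2 := by
    rw [ke_apply]
    refine intervalIntegral.integral_congr fun x hx => ?_
    simp only [kev_mem hL _ (kmem hL hx), hu T hTm]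
  have e2 : ∫ t in (0:ℝ)..T, (kO hL (v t)) ^ 2 = ∫ t in (0:ℝ)..T, (ψx L t) ^ 2 := by
    refine intervalIntegral.integral_congr fun t ht => ?_
    simp only [kO_apply, (hst t (kmem hT ht) L ⟨hL.le, le_rfl⟩).2]
  rw [e1, e2] at h
  exact h
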